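/- Let X be a random vector in ℝ^d with E X = 0 and E[|X|²] = σ²d; set A := E| |X|²σ^{-2} − d | and B := sup_{ξ∈S^{d−1}} E⟨X,ξ⟩². Let Z be a standard Gaussian random vector in ℝ^k. Then there is an absolute constant C such that the average over Haar-distributed θ ∈ W_{d,k} of the conditional bounded-Lipschitz distance satisfies E d_BL(X_θ, σZ) ≤ C [ (kB + B log d) B^{2/(9k+12)} / ( (kB)^{2/3} d^{2/(3k+4)} ) + σ(√k (A+1) + k)/(d−1) ]. -/

import Mathlib

open MeasureTheory ProbabilityTheory Real
open scoped ENNReal NNReal RealInnerProductSpace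

noncomputable section

/-- The Stiefel manifold: `k`-tuples of orthonormal vectors in `ℝ^d`. -/
def Stiefel (d k : ℕ) : Type :=
  {θ : Fin k → EuclideanSpace ℝ (Fin d) // Orthonormal ℝ θ}

instance (d k : ℕ) : MeasurableSpace (Stiefel d k) :=
  Subtype.instMeasurableSpace

/-- The metric `ρ` on the Stiefel manifold. -/
def stiefelDist {d k : ℕ} (θ θ' : Stiefel d k) : ℝ :=
  Real.sqrt (∑ j : Fin k, ‖θ.1 j - θ'.1 j‖ ^ 2)

/-- The projection `x ↦ (⟨x,θ₁⟩, …, ⟨x,θ_k⟩)` onto the span of `θ`. -/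
def stiefelProj {d k : ℕ} (θ : Stiefel d k) (x : EuclideanSpace ℝ (Fin d)) :
    EuclideanSpace ℝ (Fin k) :=
  (EuclideanSpace.equiv (Fin k) ℝ).symm fun i => ⟪θ.1 i, x⟫

/-- Rotation of a Stiefel frame by a linear isometry of `ℝ^d`. -/
def stiefelRotate {d k : ℕ}
    (U : EuclideanSpace ℝ (Fin d) ≃ₗᵢ[ℝ] EuclideanSpace ℝ (Fin d))
    (θ : Stiefel d k) : Stiefel d k :=
  ⟨fun i => U (θ.1 i), θ.2.comp_linearIsometryEquiv U⟩

/-- A probability measure on the Stiefel manifold is Haar if it is invariant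
under every rotation of `ℝ^d`. -/
def IsHaarStiefel {d k : ℕ} (μ : Measure (Stiefel d k)) : Prop :=
  IsProbabilityMeasure μ ∧
    ∀ U : EuclideanSpace ℝ (Fin d) ≃ₗᵢ[ℝ] EuclideanSpace ℝ (Fin d),
      μ.map (stiefelRotate U) = μ

/-- The standard Gaussian measure on `ℝ^k`. -/
def stdGaussian (k : ℕ) : Measure (EuclideanSpace ℝ (Fin k)) :=
  (Measure.pi fun _ : Fin k => gaussianReal 0 1).map
    (EuclideanSpace.equiv (Fin k) ℝ).symm

/-- The bounded-Lipschitz distance between two measures on `ℝ^k`: the supremum of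
`|∫ f dμ - ∫ f dν|` over `f` with `‖f‖_∞ ≤ 1` which are `1`-Lipschitz. -/
def dBL {k : ℕ} (μ ν : Measure (EuclideanSpace ℝ (Fin k))) : ℝ :=
  ⨆ f : {f : EuclideanSpace ℝ (Fin k) → ℝ // (∀ x, |f x| ≤ 1) ∧ LipschitzWith 1 f},
    |∫ x, f.1 x ∂μ - ∫ x, f.1 x ∂ν|

abbrev EE (n : ℕ) := EuclideanSpace ℝ (Fin n)

abbrev gam (n : ℕ) : Measure (EE n) := ProbabilityTheory.stdGaussian (EE n)

lemma stdGaussian_eq_gam (k : ℕ) : _root_.stdGaussian k = gam k := by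
  unfold _root_.stdGaussian gam
  rw [← map_pi_eq_stdGaussian]
  rfl

lemma gam_charFun (n : ℕ) (y : EE n) :
    ∫ g, Complex.exp (⟪g, y⟫ * Complex.I) ∂(gam n) = ((Real.exp (-‖y‖^2/2) : ℝ) : ℂ) := by
  rw [← charFun_apply, charFun_stdGaussian]; push_cast; rfl

lemma integrable_cos_inner {n : ℕ} (ν : Measure (EE n)) [IsFiniteMeasure ν] (y : EE n) :
    Integrable (fun g => Real.cos ⟪g, y⟫) ν := by
  refine Integrable.of_bound (C := 1) (Measurable.aestronglyMeasurable (by fun_prop)) ?_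
  filter_upwards with g using by simpa using abs_cos_le_one _

lemma integrable_sin_inner {n : ℕ} (ν : Measure (EE n)) [IsFiniteMeasure ν] (y : EE n) :
    Integrable (fun g => Real.sin ⟪g, y⟫) ν := by
  refine Integrable.of_bound (C := 1) (Measurable.aestronglyMeasurable (by fun_prop)) ?_
  filter_upwards with g using by simpa using abs_sin_le_one _

lemma charFun_eq_cos_sin {n : ℕ} (ν : Measure (EE n)) [IsFiniteMeasure ν] (y : EE n) :
    charFun ν y = ((∫ g, Real.cos ⟪g, y⟫ ∂ν : ℝ) : ℂ) + ((∫ g, Real.sin ⟪g, y⟫ ∂ν : ℝ) : ℂ) * Complex.I := by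
  rw [charFun_apply]
  have : ∀ g : EE n, Complex.exp (⟪g, y⟫ * Complex.I) =
      ((Real.cos ⟪g, y⟫ : ℝ) : ℂ) + ((Real.sin ⟪g, y⟫ : ℝ) : ℂ) * Complex.I := by
    intro g; rw [Complex.exp_mul_I]; push_cast; rfl
  simp_rw [this]
  rw [integral_add, integral_mul_const, integral_complex_ofReal, integral_complex_ofReal]
  · exact (integrable_cos_inner ν y).ofReal
  · exact ((integrable_sin_inner ν y).ofReal).mul_const _

lemma gam_cos (n : ℕ) (y : EE n) : ∫ g, Real.cos ⟪g, y⟫ ∂(gam n) = Real.exp (-‖y‖^2/2) := by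
  have h := charFun_eq_cos_sin (gam n) y
  rw [charFun_apply, gam_charFun] at h
  have := congrArg Complex.re h
  rw [Complex.ofReal_re] at this
  rw [this]; simp

lemma gam_sin (n : ℕ) (y : EE n) : ∫ g, Real.sin ⟪g, y⟫ ∂(gam n) = 0 := by
  have h := charFun_eq_cos_sin (gam n) y
  rw [charFun_apply, gam_charFun] at h
  have := congrArg Complex.im h
  rw [Complex.ofReal_im] at this
  simpa using this.symm

lemma memLp_sq_gaussianReal : MemLp (fun x : ℝ => x^2) 2 (gaussianReal 0 1) := by
  rw [memLp_two_iff_integrable_sq (by fun_prop)]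
  have := (memLp_id_gaussianReal (μ := 0) (v := 1) 4).integrable_norm_pow (by norm_num)
  refine this.congr ?_
  filter_upwards with x
  simp; rw [← pow_mul]; norm_num
  exact (Even.pow_abs (by decide) x)

lemma integral_sq_gaussianReal : ∫ x, x^2 ∂(gaussianReal 0 1) = 1 := by
  have := variance_fun_id_gaussianReal (μ := 0) (v := 1)
  rw [variance_eq_integral (by fun_prop)] at this
  simpa using this

lemma gam_eq_map (n : ℕ) : gam n = (Measure.pi (fun _ : Fin n ↦ gaussianReal 0 1)).map (WithLp.toLp 2) :=
  map_pi_eq_stdGaussian.symm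

lemma gam_integrable_normsq (n : ℕ) : Integrable (fun g : EE n => ‖g‖^2) (gam n) := by
  have := (IsGaussian.memLp_two_id (μ := gam n)).integrable_norm_pow (by norm_num)
  simpa using this

lemma integrable_eval_sq (n : ℕ) (i : Fin n) :
    Integrable (fun x : Fin n → ℝ => (x i)^2) (Measure.pi (fun _ : Fin n ↦ gaussianReal 0 1)) :=
  integrable_comp_eval (μ := fun _ : Fin n => gaussianReal 0 1) (i := i) (f := fun x : ℝ => x^2)
    (memLp_sq_gaussianReal.integrable (by norm_num))

lemma integral_eval_sq (n : ℕ) (i : Fin n) :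
    ∫ x : Fin n → ℝ, (x i)^2 ∂(Measure.pi (fun _ : Fin n ↦ gaussianReal 0 1)) = 1 := by
  have := integral_comp_eval (μ := fun _ : Fin n => gaussianReal 0 1) (i := i) (f := fun x : ℝ => x^2)
    (by fun_prop)
  rw [this, integral_sq_gaussianReal]

lemma gam_normsq (n : ℕ) : ∫ g, ‖g‖^2 ∂(gam n) = n := by
  rw [gam_eq_map, integral_map (by fun_prop) (by fun_prop)]
  simp_rw [EuclideanSpace.real_norm_sq_eq]
  rw [integral_finsetSum _ (fun i _ => integrable_eval_sq n i)]
  simp [integral_eval_sq]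

/-- fourth-moment constant -/
def VV : ℝ := Var[fun x : ℝ => x^2; gaussianReal 0 1]

lemma VV_nonneg : 0 ≤ VV := variance_nonneg _ _

lemma gam_fourth (n : ℕ) : Integrable (fun g : EE n => (‖g‖^2 - n)^2) (gam n) ∧
    ∫ g, (‖g‖^2 - n)^2 ∂(gam n) = VV * n := by
  have hm : ∀ i : Fin n, MemLp (fun x : ℝ => x^2) 2 (gaussianReal 0 1) := fun i => memLp_sq_gaussianReal
  have hv := variance_sum_pi (ι := Fin n) (μ := fun _ => gaussianReal 0 1) (X := fun i (x : ℝ) => x^2) hm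
  have hmem : MemLp (∑ i : Fin n, fun (x : Fin n → ℝ) => (x i)^2) 2 (Measure.pi (fun _ : Fin n ↦ gaussianReal 0 1)) := by
    refine memLp_finsetSum' _ (fun i _ => ?_)
    exact (memLp_sq_gaussianReal.comp_measurePreserving (measurePreserving_eval (fun _ : Fin n => gaussianReal 0 1) i))
  have hmean : ∫ x : Fin n → ℝ, (∑ i : Fin n, fun (x : Fin n → ℝ) => (x i)^2) x ∂(Measure.pi (fun _ : Fin n ↦ gaussianReal 0 1)) = n := by
    simp only [Finset.sum_apply]
    rw [integral_finsetSum _ (fun i _ => integrable_eval_sq n i)]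
    simp [integral_eval_sq]
  constructor
  · rw [gam_eq_map, integrable_map_measure (by fun_prop) (by fun_prop)]
    have := (hmem.sub (memLp_const (n:ℝ))).integrable_sq
    refine this.congr ?_
    filter_upwards with x
    simp [EuclideanSpace.real_norm_sq_eq]
  · rw [variance_eq_integral (hmem.aestronglyMeasurable.aemeasurable), hmean] at hv
    rw [gam_eq_map, integral_map (by fun_prop) (by fun_prop)]
    simp_rw [EuclideanSpace.real_norm_sq_eq]
    simp only [Finset.sum_apply] at hv
    rw [hv]; simp [VV, mul_comm]

lemma gam_ne_zero (n : ℕ) (hn : 0 < n) : ∀ᵐ g ∂(gam n), g ≠ 0 := by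
  rw [gam_eq_map, ae_map_iff (p := fun g : EE n => g ≠ 0) (by fun_prop) (measurableSet_singleton (0 : EE n)).compl]
  have := (measurePreserving_eval (fun _ : Fin n => gaussianReal 0 1) ⟨0, hn⟩)
  have h0 : ∀ᵐ x ∂(gaussianReal 0 1), x ≠ 0 := by
    have := nullSingletonClass_gaussianReal (μ := 0) (v := 1) (by norm_num)
    simp [ae_iff]
  have h1 := this.quasiMeasurePreserving.ae h0
  filter_upwards [h1] with x hx h
  apply hx
  have : (WithLp.toLp 2 x : EE n) ⟨0, hn⟩ = 0 := by rw [h]; rfl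
  simpa using this

lemma charFun_rot {d : ℕ} (ν : Measure (EE d))
    (hU : ∀ U : EE d ≃ₗᵢ[ℝ] EE d, ν.map U = ν) {y z : EE d} (h : ‖y‖ = ‖z‖) :
    charFun ν y = charFun ν z := by
  let U := Submodule.reflection (ℝ ∙ (y - z))ᗮ
  have hz : U y = z := Submodule.reflection_sub h
  rw [charFun_apply, charFun_apply, ← hz]
  conv_rhs => rw [← hU U]
  rw [integral_map U.continuous.measurable.aemeasurable
    (Measurable.aestronglyMeasurable (by fun_prop))]
  simp_rw [LinearIsometryEquiv.inner_map_map]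

lemma charFun_cross {d : ℕ} (ν ν' : Measure (EE d)) [IsProbabilityMeasure ν]
    [IsProbabilityMeasure ν'] {r : ℝ} (hr : 0 < r)
    (h2 : ∀ᵐ u ∂ν', ‖u‖ = r)
    (hU : ∀ U : EE d ≃ₗᵢ[ℝ] EE d, ν.map U = ν) (y : EE d) :
    charFun ν y = ∫ w, ∫ u, Complex.exp (((‖y‖ / r) * ⟪u, w⟫ : ℝ) * Complex.I) ∂ν ∂ν' := by
  have : ∀ᵐ w ∂ν', (∫ u, Complex.exp (((‖y‖ / r) * ⟪u, w⟫ : ℝ) * Complex.I) ∂ν) = charFun ν y := by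
    filter_upwards [h2] with w hw
    rw [charFun_rot ν hU (y := y) (z := (‖y‖ / r) • w), charFun_apply]
    · simp_rw [inner_smul_right]
    · rw [norm_smul, hw, Real.norm_of_nonneg (by positivity)]; field_simp
  rw [integral_congr_ae this]; simp

lemma sphere_unique {d : ℕ} (ν ν' : Measure (EE d)) [IsProbabilityMeasure ν]
    [IsProbabilityMeasure ν'] {r : ℝ} (hr : 0 < r)
    (h1 : ∀ᵐ u ∂ν, ‖u‖ = r) (h2 : ∀ᵐ u ∂ν', ‖u‖ = r)
    (hU : ∀ U : EE d ≃ₗᵢ[ℝ] EE d, ν.map U = ν)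
    (hU' : ∀ U : EE d ≃ₗᵢ[ℝ] EE d, ν'.map U = ν') : ν = ν' := by
  apply Measure.ext_of_charFun
  ext y
  rw [charFun_cross ν ν' hr h2 hU, charFun_cross ν' ν hr h1 hU', integral_integral_swap]
  · simp_rw [real_inner_comm]
  · refine Integrable.of_bound (C := 1) (Measurable.aestronglyMeasurable (by fun_prop)) ?_
    filter_upwards with g 
    simp only [Function.uncurry]
    rw [Complex.norm_exp_ofReal_mul_I]

/-- direction vector -/
def vth {d k : ℕ} (t : EE k) (θ : Stiefel d k) : EE d := ∑ j, t j • θ.1 j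

lemma measurable_coe_stiefel {d k : ℕ} (j : Fin k) : Measurable (fun θ : Stiefel d k => θ.1 j) :=
  (measurable_pi_apply j).comp measurable_subtype_coe

lemma measurable_vth {d k : ℕ} : Measurable (fun p : Stiefel d k × EE k => vth p.2 p.1) := by
  unfold vth
  refine Finset.measurable_sum _ (fun j _ => ?_)
  have : Measurable (fun p : Stiefel d k × EE k => p.1.1 j) :=
    (measurable_coe_stiefel (d := d) j).comp measurable_fst
  have h2 : Measurable (fun p : Stiefel d k × EE k => p.2 j) := by fun_prop
  exact h2.smul this

lemma measurable_vth' {d k : ℕ} (t : EE k) : Measurable (fun θ : Stiefel d k => vth t θ) :=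
  measurable_vth.comp (measurable_id.prodMk measurable_const)

lemma inner_vth {d k : ℕ} (t : EE k) (θ : Stiefel d k) (x : EE d) :
    ⟪stiefelProj θ x, t⟫ = ⟪x, vth t θ⟫ := by
  unfold vth stiefelProj
  rw [inner_sum, PiLp.inner_apply]
  refine Finset.sum_congr rfl (fun j _ => ?_)
  rw [inner_smul_right]
  have : ⟪x, θ.1 j⟫ = ⟪θ.1 j, x⟫ := real_inner_comm _ _
  rw [this]
  simp

lemma norm_vth {d k : ℕ} (t : EE k) (θ : Stiefel d k) : ‖vth t θ‖ = ‖t‖ := by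
  have h : ‖vth t θ‖^2 = ‖t‖^2 := by
    rw [← real_inner_self_eq_norm_sq, EuclideanSpace.real_norm_sq_eq]
    unfold vth
    rw [θ.2.inner_sum]
    simp [sq]
  exact (pow_left_inj₀ (norm_nonneg _) (norm_nonneg _) two_ne_zero).1 h

lemma norm_stiefelProj_le {d k : ℕ} (θ : Stiefel d k) (x : EE d) : ‖stiefelProj θ x‖^2 = ∑ j, ⟪x, θ.1 j⟫^2 := by
  rw [EuclideanSpace.real_norm_sq_eq]
  refine Finset.sum_congr rfl (fun j _ => ?_)
  rw [real_inner_comm]; rfl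

/-- radially projected Gaussian -/
def sphG (d : ℕ) (r : ℝ) : Measure (EE d) := (gam d).map (fun g => (r * ‖g‖⁻¹) • g)

instance (d : ℕ) (r : ℝ) : IsProbabilityMeasure (sphG d r) :=
  Measure.isProbabilityMeasure_map (Measurable.aemeasurable (by fun_prop))

lemma haar_law {d k : ℕ} (hd : 0 < d) (μ : Measure (Stiefel d k)) (hμ : IsHaarStiefel μ) (t : EE k)
    (ht : t ≠ 0) : μ.map (vth t) = sphG d ‖t‖ := by
  have := hμ.1
  have : IsProbabilityMeasure (μ.map (vth t)) :=
    Measure.isProbabilityMeasure_map (measurable_vth' t).aemeasurable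
  refine sphere_unique _ _ (norm_pos_iff.2 ht) ?_ ?_ ?_ ?_
  · rw [ae_map_iff (measurable_vth' t).aemeasurable (measurableSet_eq_fun (by fun_prop) (by fun_prop))]
    filter_upwards with θ using norm_vth t θ
  · unfold sphG
    rw [ae_map_iff (Measurable.aemeasurable (by fun_prop)) (measurableSet_eq_fun (by fun_prop) (by fun_prop))]
    filter_upwards [gam_ne_zero d hd] with g hg
    have : ‖g‖ ≠ 0 := norm_ne_zero_iff.2 hg
    rw [norm_smul, norm_mul]; simp; field_simp
  · intro U
    have hR : Measurable (stiefelRotate (d := d) (k := k) U) := by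
      unfold stiefelRotate
      refine Measurable.subtype_mk ?_
      refine measurable_pi_lambda _ (fun i => ?_)
      exact U.continuous.measurable.comp (measurable_coe_stiefel i)
    rw [Measure.map_map U.continuous.measurable (measurable_vth' t)]
    conv_rhs => rw [← hμ.2 U]
    rw [Measure.map_map (measurable_vth' t) hR]
    congr 1
    ext1 θ
    simp [vth, stiefelRotate]
  · intro U
    unfold sphG
    rw [Measure.map_map U.continuous.measurable (by fun_prop)]
    have h := stdGaussian_map (E := EE d) U
    conv_rhs => rw [show gam d = ProbabilityTheory.stdGaussian (EE d) from rfl, ← h]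
    rw [Measure.map_map (by fun_prop) U.continuous.measurable]
    congr 1
    ext1 g
    simp

lemma sq_integral_le {α : Type*} [MeasurableSpace α] (ν : Measure α) [IsProbabilityMeasure ν]
    {f : α → ℝ} (hf : AEStronglyMeasurable f ν) (h : Integrable (fun x => f x ^ 2) ν) :
    (∫ x, f x ∂ν)^2 ≤ ∫ x, f x ^ 2 ∂ν := by
  have h2 : MemLp f 2 ν := (memLp_two_iff_integrable_sq hf).2 h
  have := variance_nonneg f ν
  rw [variance_eq_sub h2] at this
  have e : ν[f ^ 2] = ∫ x, f x ^ 2 ∂ν := rfl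
  linarith

def Fc {d : ℕ} (Λ : Measure (EE d)) (v : EE d) : ℝ := ∫ x, Real.cos ⟪x, v⟫ ∂Λ
def Fs {d : ℕ} (Λ : Measure (EE d)) (v : EE d) : ℝ := ∫ x, Real.sin ⟪x, v⟫ ∂Λ
def mm {d : ℕ} (Λ : Measure (EE d)) (a : ℝ) : ℝ := ∫ x, Real.exp (-(a^2 * ‖x‖^2)/2) ∂Λ

section
variable {d : ℕ} (Λ : Measure (EE d)) [IsProbabilityMeasure Λ]

lemma measurable_Fc : Measurable (Fc Λ) := by
  have : StronglyMeasurable (fun p : EE d × EE d => Real.cos ⟪p.2, p.1⟫) :=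
    Measurable.stronglyMeasurable (by fun_prop)
  exact (this.integral_prod_right (ν := Λ)).measurable

lemma measurable_Fs : Measurable (Fs Λ) := by
  have : StronglyMeasurable (fun p : EE d × EE d => Real.sin ⟪p.2, p.1⟫) :=
    Measurable.stronglyMeasurable (by fun_prop)
  exact (this.integral_prod_right (ν := Λ)).measurable

lemma abs_integral_le_one {α : Type*} [MeasurableSpace α] (ν : Measure α) [IsProbabilityMeasure ν]
    {f : α → ℝ} (h : ∀ x, |f x| ≤ 1) : |∫ x, f x ∂ν| ≤ 1 := by
  have := norm_integral_le_of_norm_le_const (μ := ν) (f := f) (C := 1) (by filter_upwards with x using h x)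
  simpa using this

lemma abs_Fc_le (v : EE d) : |Fc Λ v| ≤ 1 := abs_integral_le_one Λ (fun _ => abs_cos_le_one _)
lemma abs_Fs_le (v : EE d) : |Fs Λ v| ≤ 1 := abs_integral_le_one Λ (fun _ => abs_sin_le_one _)
lemma abs_mm_le (a : ℝ) : |mm Λ a| ≤ 1 := abs_integral_le_one Λ (fun x => by
  rw [abs_of_pos (exp_pos _), exp_le_one_iff]
  have : 0 ≤ a^2 * ‖x‖^2 := by positivity
  linarith)

lemma integrable_of_meas_bdd {α : Type*} [MeasurableSpace α] (ν : Measure α) [IsFiniteMeasure ν]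
    {f : α → ℝ} (hf : Measurable f) (C : ℝ) (h : ∀ x, |f x| ≤ C) : Integrable f ν :=
  Integrable.of_bound (C := C) hf.aestronglyMeasurable (by filter_upwards with x using h x)

lemma Fcs_sq (v : EE d) : Fc Λ v ^ 2 + Fs Λ v ^ 2 = ∫ p, Real.cos ⟪p.1 - p.2, v⟫ ∂(Λ.prod Λ) := by
  have h1 : ∀ p : EE d × EE d, Real.cos ⟪p.1 - p.2, v⟫ =
      Real.cos ⟪p.1, v⟫ * Real.cos ⟪p.2, v⟫ + Real.sin ⟪p.1, v⟫ * Real.sin ⟪p.2, v⟫ := by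
    intro p; rw [inner_sub_left, Real.cos_sub]
  simp_rw [h1]
  rw [integral_add, integral_prod_mul (fun x => Real.cos ⟪x, v⟫) (fun x => Real.cos ⟪x, v⟫),
    integral_prod_mul (fun x => Real.sin ⟪x, v⟫) (fun x => Real.sin ⟪x, v⟫)]
  · unfold Fc Fs; ring
  · exact (integrable_cos_inner Λ v).mul_prod (integrable_cos_inner Λ v)
  · exact (integrable_sin_inner Λ v).mul_prod (integrable_sin_inner Λ v)

lemma int_Fc_gam (a : ℝ) : ∫ g, Fc Λ (a • g) ∂(gam d) = mm Λ a := by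
  unfold Fc mm
  rw [integral_integral_swap]
  · refine integral_congr_ae ?_
    filter_upwards with x
    have := gam_cos d (a • x)
    rw [norm_smul, mul_pow, Real.norm_eq_abs, sq_abs] at this
    rw [← this]
    refine integral_congr_ae ?_
    filter_upwards with g
    rw [inner_smul_right, inner_smul_right, real_inner_comm]
  · exact integrable_of_meas_bdd _ (by unfold Function.uncurry; fun_prop) 1 (fun _ => abs_cos_le_one _)

lemma integrable_inner_sq (hX : Integrable (fun x : EE d => ‖x‖^2) Λ) (v : EE d) : Integrable (fun x : EE d => ⟪x, v⟫^2) Λ := by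
  refine (hX.mul_const (‖v‖^2)).mono' (Measurable.aestronglyMeasurable (by fun_prop)) ?_
  filter_upwards with x
  rw [Real.norm_eq_abs, abs_of_nonneg (sq_nonneg _), ← mul_pow, ← sq_abs]
  exact pow_le_pow_left₀ (abs_nonneg _) (abs_real_inner_le_norm _ _) 2

lemma integrable_norm_of_sq (hX : Integrable (fun x : EE d => ‖x‖^2) Λ) : Integrable (fun x : EE d => ‖x‖) Λ := by
  refine (hX.add (integrable_const 1)).mono' (Measurable.aestronglyMeasurable (by fun_prop)) ?_
  filter_upwards with x
  simp only [norm_norm, Pi.add_apply]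
  nlinarith [sq_nonneg (‖x‖ - 1), norm_nonneg x]

lemma integrable_coord_mul (hX : Integrable (fun x : EE d => ‖x‖^2) Λ) (i : Fin d) {f : EE d → ℝ} (hf : Measurable f) (hb : ∀ x, |f x| ≤ 1) :
    Integrable (fun x : EE d => x i * f x) Λ := by
  refine (integrable_norm_of_sq Λ hX).mono' (Measurable.aestronglyMeasurable (by fun_prop)) ?_
  filter_upwards with x
  rw [norm_mul]
  have h1 : ‖x i‖ ≤ ‖x‖ := PiLp.norm_apply_le x i
  have h2 : ‖f x‖ ≤ 1 := hb x
  nlinarith [norm_nonneg x, norm_nonneg (x i), norm_nonneg (f x)]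

lemma sum_coord_sq_le (hX : Integrable (fun x : EE d => ‖x‖^2) Λ) {B : ℝ} (hB0 : 0 < B)
    (hB : ∀ v : EE d, ∫ x, ⟪x, v⟫^2 ∂Λ ≤ B * ‖v‖^2)
    {f : EE d → ℝ} (hf : Measurable f) (hb : ∀ x, |f x| ≤ 1) :
    ∑ i, (∫ x, x i * f x ∂Λ)^2 ≤ B := by
  set w : EE d := WithLp.toLp 2 (fun i => ∫ x, x i * f x ∂Λ) with hw
  have hwi : ∀ i, w i = ∫ x, x i * f x ∂Λ := fun i => rfl
  have hn : ‖w‖^2 = ∑ i, (∫ x, x i * f x ∂Λ)^2 := by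
    rw [EuclideanSpace.real_norm_sq_eq]
  have h1 : ‖w‖^2 = ∫ x, ⟪x, w⟫ * f x ∂Λ := by
    have : ∀ x : EE d, ⟪x, w⟫ * f x = ∑ i, w i * (x i * f x) := by
      intro x
      rw [PiLp.inner_apply, Finset.sum_mul]
      refine Finset.sum_congr rfl (fun i _ => ?_)
      simp; ring
    simp_rw [this]
    rw [integral_finsetSum _ (fun i _ => (integrable_coord_mul Λ hX i hf hb).const_mul _)]
    simp_rw [integral_const_mul, ← hwi]
    rw [EuclideanSpace.real_norm_sq_eq]
    simp_rw [sq]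
  have h2 : ‖w‖^2 ≤ ∫ x, (⟪x, w⟫^2 / (2*B) + B/2) ∂Λ := by
    rw [h1]
    have hi := (integrable_inner_sq Λ hX w)
    have hle : ∀ x, |⟪x, w⟫ * f x| ≤ ⟪x, w⟫^2 / (2*B) + B/2 := by
      intro x
      have e : ⟪x, w⟫^2 / (2*B) + B/2 - |⟪x, w⟫| = (|⟪x, w⟫| - B)^2 / (2*B) := by
        rw [← sq_abs ⟪x, w⟫]; field_simp; ring
      have : 0 ≤ (|⟪x, w⟫| - B)^2 / (2*B) := by positivity
      rw [abs_mul]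
      nlinarith [abs_nonneg ⟪x, w⟫, hb x]
    have hi2 : Integrable (fun x => ⟪x, w⟫^2 / (2*B) + B/2) Λ := (hi.div_const _).add (integrable_const _)
    refine integral_mono (hi2.mono' (Measurable.aestronglyMeasurable (by fun_prop)) ?_) hi2 ?_
    · filter_upwards with x using hle x
    · intro x; exact (le_abs_self _).trans (hle x)
  rw [integral_add ((integrable_inner_sq Λ hX w).div_const _) (integrable_const _), integral_div] at h2
  simp only [integral_const, probReal_univ, smul_eq_mul, one_mul] at h2
  have h3 := hB w
  have h4 : (∫ x, ⟪x, w⟫^2 ∂Λ) / (2*B) ≤ ‖w‖^2/2 := by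
    rw [div_le_iff₀ (by positivity)]; linarith
  rw [← hn]; linarith

lemma integrable_prod_coord (hX : Integrable (fun x : EE d => ‖x‖^2) Λ) (i : Fin d) (v : EE d) :
    Integrable (fun p : EE d × EE d => p.1 i * p.2 i * Real.cos ⟪p.1 - p.2, v⟫) (Λ.prod Λ) := by
  have hn := integrable_norm_of_sq Λ hX
  refine (hn.mul_prod hn).mono' (Measurable.aestronglyMeasurable (by fun_prop)) ?_
  filter_upwards with p
  rw [norm_mul, norm_mul]
  have h1 : ‖p.1 i‖ ≤ ‖p.1‖ := PiLp.norm_apply_le _ i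
  have h1 : ‖p.2 i‖ ≤ ‖p.2‖ := PiLp.norm_apply_le _ i
  have h2 : ‖Real.cos ⟪p.1 - p.2, v⟫‖ ≤ 1 := abs_cos_le_one _
  calc _ ≤ ‖p.1‖ * ‖p.2‖ * 1 := by gcongr
    _ = _ := by ring

lemma integrable_prod_inner (hX : Integrable (fun x : EE d => ‖x‖^2) Λ) (f : EE d × EE d → ℝ) (hf : Measurable f) (hb : ∀ p, |f p| ≤ 1) :
    Integrable (fun p : EE d × EE d => ⟪p.1, p.2⟫ * f p) (Λ.prod Λ) := by
  have hn := integrable_norm_of_sq Λ hX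
  refine (hn.mul_prod hn).mono' (Measurable.aestronglyMeasurable (by fun_prop)) ?_
  filter_upwards with p
  rw [norm_mul]
  have h1 : ‖⟪p.1, p.2⟫‖ ≤ ‖p.1‖ * ‖p.2‖ := abs_real_inner_le_norm _ _
  have h2 : ‖f p‖ ≤ 1 := hb p
  calc _ ≤ (‖p.1‖ * ‖p.2‖) * 1 := by gcongr
    _ = _ := by ring

lemma inner_cos_le (hX : Integrable (fun x : EE d => ‖x‖^2) Λ) {B : ℝ} (hB0 : 0 < B)
    (hB : ∀ v : EE d, ∫ x, ⟪x, v⟫^2 ∂Λ ≤ B * ‖v‖^2)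
    (v : EE d) : ∫ p, ⟪p.1, p.2⟫ * Real.cos ⟪p.1 - p.2, v⟫ ∂(Λ.prod Λ) ≤ 2 * B := by
  have h1 : ∀ p : EE d × EE d, ⟪p.1, p.2⟫ * Real.cos ⟪p.1 - p.2, v⟫ =
      ∑ i, ((p.1 i * Real.cos ⟪p.1, v⟫) * (p.2 i * Real.cos ⟪p.2, v⟫) +
        (p.1 i * Real.sin ⟪p.1, v⟫) * (p.2 i * Real.sin ⟪p.2, v⟫)) := by
    intro p
    rw [inner_sub_left, Real.cos_sub, PiLp.inner_apply, Finset.sum_mul]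
    refine Finset.sum_congr rfl (fun i _ => ?_)
    simp; ring
  have hc : ∀ i, Integrable (fun x : EE d => x i * Real.cos ⟪x, v⟫) Λ := fun i =>
    integrable_coord_mul Λ hX i (by fun_prop) (fun _ => abs_cos_le_one _)
  have hs : ∀ i, Integrable (fun x : EE d => x i * Real.sin ⟪x, v⟫) Λ := fun i =>
    integrable_coord_mul Λ hX i (by fun_prop) (fun _ => abs_sin_le_one _)
  simp_rw [h1]
  rw [integral_finsetSum]
  · have : ∀ i, ∫ p : EE d × EE d, ((p.1 i * Real.cos ⟪p.1, v⟫) * (p.2 i * Real.cos ⟪p.2, v⟫) +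
        (p.1 i * Real.sin ⟪p.1, v⟫) * (p.2 i * Real.sin ⟪p.2, v⟫)) ∂(Λ.prod Λ) =
        (∫ x, x i * Real.cos ⟪x, v⟫ ∂Λ)^2 + (∫ x, x i * Real.sin ⟪x, v⟫ ∂Λ)^2 := by
      intro i
      rw [integral_add ((hc i).mul_prod (hc i)) ((hs i).mul_prod (hs i)),
        integral_prod_mul (fun x : EE d => x i * Real.cos ⟪x, v⟫) (fun x : EE d => x i * Real.cos ⟪x, v⟫),
        integral_prod_mul (fun x : EE d => x i * Real.sin ⟪x, v⟫) (fun x : EE d => x i * Real.sin ⟪x, v⟫)]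
      ring
    simp_rw [this]
    rw [Finset.sum_add_distrib]
    have a1 := sum_coord_sq_le Λ hX hB0 hB (f := fun x => Real.cos ⟪x, v⟫) (by fun_prop) (fun _ => abs_cos_le_one _)
    have a2 := sum_coord_sq_le Λ hX hB0 hB (f := fun x => Real.sin ⟪x, v⟫) (by fun_prop) (fun _ => abs_sin_le_one _)
    linarith
  · intro i _
    exact ((hc i).mul_prod (hc i)).add ((hs i).mul_prod (hs i))

/-- Gaussian variance bound. -/
lemma gauss_var (hX : Integrable (fun x : EE d => ‖x‖^2) Λ) {B : ℝ} (hB0 : 0 < B)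
    (hB : ∀ v : EE d, ∫ x, ⟪x, v⟫^2 ∂Λ ≤ B * ‖v‖^2)
    (a : ℝ) :
    ∫ g, ((Fc Λ (a • g) - mm Λ a)^2 + Fs Λ (a • g)^2) ∂(gam d) ≤ 2 * a^2 * B := by
  have mFc := measurable_Fc Λ
  have mFs := measurable_Fs Λ
  have iFc : Integrable (fun g => Fc Λ (a • g)) (gam d) :=
    integrable_of_meas_bdd _ (by fun_prop) 1 (fun _ => abs_Fc_le Λ _)
  have iN : Integrable (fun g => Fc Λ (a • g)^2 + Fs Λ (a • g)^2) (gam d) := by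
    refine integrable_of_meas_bdd _ (by fun_prop) 2 (fun g => ?_)
    have h1 := abs_Fc_le Λ (a • g)
    have h2 := abs_Fs_le Λ (a • g)
    rw [← sq_abs, ← sq_abs (Fs _ _), abs_of_nonneg (by positivity)]
    nlinarith [abs_nonneg (Fc Λ (a • g)), abs_nonneg (Fs Λ (a • g))]
  have e1 : ∫ g, ((Fc Λ (a • g) - mm Λ a)^2 + Fs Λ (a • g)^2) ∂(gam d) =
      ∫ g, (Fc Λ (a • g)^2 + Fs Λ (a • g)^2) ∂(gam d) - mm Λ a ^ 2 := by
    have : ∀ g, ((Fc Λ (a • g) - mm Λ a)^2 + Fs Λ (a • g)^2) =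
      (Fc Λ (a • g)^2 + Fs Λ (a • g)^2) - (2 * mm Λ a * Fc Λ (a • g) - mm Λ a ^ 2) := by intro g; ring
    simp_rw [this]
    have iK : Integrable (fun g => 2 * mm Λ a * Fc Λ (a • g) - mm Λ a ^ 2) (gam d) :=
      (iFc.const_mul _).sub (integrable_const _)
    rw [integral_sub iN iK, integral_sub (iFc.const_mul _) (integrable_const _), integral_const_mul, int_Fc_gam]
    simp; ring
  have gc : ∀ p : EE d × EE d, ∫ g, Real.cos ⟪p.1 - p.2, a • g⟫ ∂(gam d) = Real.exp (-(a^2 * ‖p.1 - p.2‖^2)/2) := by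
    intro p
    have := gam_cos d (a • (p.1 - p.2))
    rw [norm_smul, mul_pow, Real.norm_eq_abs, sq_abs] at this
    rw [← this]
    refine integral_congr_ae ?_
    filter_upwards with g
    rw [inner_smul_right, inner_smul_right, real_inner_comm]
  have e2 : ∫ g, (Fc Λ (a • g)^2 + Fs Λ (a • g)^2) ∂(gam d) =
      ∫ p, Real.exp (-(a^2 * ‖p.1 - p.2‖^2)/2) ∂(Λ.prod Λ) := by
    simp_rw [Fcs_sq]
    rw [integral_integral_swap]
    · simp_rw [gc]
    · exact integrable_of_meas_bdd _ (by unfold Function.uncurry; fun_prop) 1 (fun _ => abs_cos_le_one _)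
  have e3 : mm Λ a ^ 2 = ∫ p, Real.exp (-(a^2 * ‖p.1‖^2)/2) * Real.exp (-(a^2 * ‖p.2‖^2)/2) ∂(Λ.prod Λ) := by
    rw [integral_prod_mul (fun x : EE d => Real.exp (-(a^2 * ‖x‖^2)/2)) (fun x : EE d => Real.exp (-(a^2 * ‖x‖^2)/2))]
    unfold mm; ring
  have expb : ∀ r : ℝ, 0 ≤ r → |Real.exp (-r/2)| ≤ 1 := by
    intro r hr
    rw [abs_of_pos (exp_pos _), exp_le_one_iff]; linarith
  have i1 : Integrable (fun p : EE d × EE d => Real.exp (-(a^2 * ‖p.1 - p.2‖^2)/2)) (Λ.prod Λ) :=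
    integrable_of_meas_bdd _ (by fun_prop) 1 (fun p => expb _ (by positivity))
  have i2 : Integrable (fun p : EE d × EE d => Real.exp (-(a^2 * ‖p.1‖^2)/2) * Real.exp (-(a^2 * ‖p.2‖^2)/2)) (Λ.prod Λ) := by
    refine integrable_of_meas_bdd _ (by fun_prop) 1 (fun p => ?_)
    rw [abs_mul]
    exact mul_le_one₀ (expb _ (by positivity)) (abs_nonneg _) (expb _ (by positivity))
  have i3 : Integrable (fun p : EE d × EE d => ⟪p.1, p.2⟫ * Real.exp (-(a^2 * ‖p.1 - p.2‖^2)/2)) (Λ.prod Λ) :=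
    integrable_prod_inner Λ hX _ (by fun_prop) (fun p => expb _ (by positivity))
  have e4 : ∫ p : EE d × EE d, ⟪p.1, p.2⟫ * Real.exp (-(a^2 * ‖p.1 - p.2‖^2)/2) ∂(Λ.prod Λ) ≤ 2 * B := by
    have : ∀ p : EE d × EE d, ⟪p.1, p.2⟫ * Real.exp (-(a^2 * ‖p.1 - p.2‖^2)/2) =
        ∫ g, ⟪p.1, p.2⟫ * Real.cos ⟪p.1 - p.2, a • g⟫ ∂(gam d) := by
      intro p; rw [integral_const_mul, gc]
    simp_rw [this]
    have hInt : Integrable (Function.uncurry fun (p : EE d × EE d) (g : EE d) => ⟪p.1, p.2⟫ * Real.cos ⟪p.1 - p.2, a • g⟫)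
        ((Λ.prod Λ).prod (gam d)) := by
      have hi := (integrable_prod_inner Λ hX (fun _ => 1) (by fun_prop) (by simp)).norm
      have := hi.mul_prod (integrable_const (μ := gam d) (1:ℝ))
      refine this.mono' (Measurable.aestronglyMeasurable (by unfold Function.uncurry; fun_prop)) ?_
      filter_upwards with q
      simp only [Function.uncurry, norm_mul, mul_one, norm_one]
      exact mul_le_of_le_one_right (norm_nonneg _) (abs_cos_le_one _)
    rw [integral_integral_swap hInt]
    calc _ ≤ ∫ g, 2 * B ∂(gam d) := by
          refine integral_mono hInt.integral_prod_right (integrable_const _) (fun g => ?_)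
          exact inner_cos_le Λ hX hB0 hB (a • g)
      _ = 2 * B := by simp
  rw [e1, e2, e3, ← integral_sub i1 i2]
  calc _ ≤ ∫ p : EE d × EE d, a^2 * (⟪p.1, p.2⟫ * Real.exp (-(a^2 * ‖p.1 - p.2‖^2)/2)) ∂(Λ.prod Λ) := by
        refine integral_mono (i1.sub i2) (i3.const_mul _) (fun p => ?_)
        simp only
        have key : Real.exp (-(a^2 * ‖p.1‖^2)/2) * Real.exp (-(a^2 * ‖p.2‖^2)/2) =
            Real.exp (-(a^2 * ‖p.1 - p.2‖^2)/2) * Real.exp (-(a^2 * ⟪p.1, p.2⟫)) := by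
          rw [← Real.exp_add, ← Real.exp_add]
          congr 1
          rw [norm_sub_sq_real]; ring
        rw [key]
        have := Real.add_one_le_exp (-(a^2 * ⟪p.1, p.2⟫))
        nlinarith [Real.exp_pos (-(a^2 * ‖p.1 - p.2‖^2)/2)]
    _ ≤ _ := by
        rw [integral_const_mul]
        nlinarith [sq_nonneg a]

lemma Fcs_lip (hX : Integrable (fun x : EE d => ‖x‖^2) Λ) {B : ℝ} (hB0 : 0 < B)
    (hB : ∀ v : EE d, ∫ x, ⟪x, v⟫^2 ∂Λ ≤ B * ‖v‖^2)
    (v w : EE d) : (Fc Λ v - Fc Λ w)^2 ≤ B * ‖v - w‖^2 ∧ (Fs Λ v - Fs Λ w)^2 ≤ B * ‖v - w‖^2 := by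
  have hi := integrable_inner_sq Λ hX (v - w)
  have aux : ∀ f : ℝ → ℝ, Measurable f → (∀ x, |f x| ≤ 1) → (∀ x y, |f x - f y| ≤ |x - y|) →
      (∫ x, f ⟪x, v⟫ ∂Λ - ∫ x, f ⟪x, w⟫ ∂Λ)^2 ≤ B * ‖v - w‖^2 := by
    intro f hf hb hl
    have hle : ∀ x : EE d, (f ⟪x, v⟫ - f ⟪x, w⟫)^2 ≤ ⟪x, v - w⟫^2 := by
      intro x
      rw [inner_sub_right]
      exact sq_le_sq.2 (hl _ _)
    have hi' : Integrable (fun x : EE d => (f ⟪x, v⟫ - f ⟪x, w⟫)^2) Λ := by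
      refine hi.mono' (Measurable.aestronglyMeasurable (by fun_prop)) ?_
      filter_upwards with x
      rw [Real.norm_of_nonneg (sq_nonneg _)]; exact hle x
    rw [← integral_sub (integrable_of_meas_bdd _ (by fun_prop) 1 (fun _ => hb _))
      (integrable_of_meas_bdd _ (by fun_prop) 1 (fun _ => hb _))]
    refine (sq_integral_le Λ (Measurable.aestronglyMeasurable (by fun_prop)) hi').trans ?_
    exact (integral_mono hi' hi hle).trans (hB _)
  exact ⟨aux Real.cos (by fun_prop) abs_cos_le_one (fun x y => Real.abs_cos_sub_cos_le x y),
    aux Real.sin (by fun_prop) abs_sin_le_one (fun x y => Real.abs_sin_sub_sin_le x y)⟩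


def Phi (m : ℝ) (v : EE d) : ℝ := (Fc Λ v - m)^2 + Fs Λ v ^ 2

lemma Phi_bdd (m : ℝ) (hm : |m| ≤ 1) (v : EE d) : 0 ≤ Phi Λ m v ∧ Phi Λ m v ≤ 5 := by
  have h1 := abs_le.1 (abs_Fc_le Λ v)
  have h2 := abs_le.1 (abs_Fs_le Λ v)
  have h3 := abs_le.1 hm
  unfold Phi
  constructor
  · positivity
  · nlinarith

lemma measurable_Phi (m : ℝ) : Measurable (Phi Λ m) := by
  have mFc := measurable_Fc Λ
  have mFs := measurable_Fs Λ
  unfold Phi; fun_prop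

lemma haar_var (hX : Integrable (fun x : EE d => ‖x‖^2) Λ) {B : ℝ} (hB0 : 0 < B)
    (hB : ∀ v : EE d, ∫ x, ⟪x, v⟫^2 ∂Λ ≤ B * ‖v‖^2)
    {k : ℕ} (hd : 0 < d) (μ : Measure (Stiefel d k)) (hμ : IsHaarStiefel μ) (t : EE k) :
    ∫ θ, Phi Λ (mm Λ (‖t‖ / √d)) (vth t θ) ∂μ ≤ (4 + 4 * VV) * (B * ‖t‖^2 / d) := by
  have hd' : (0:ℝ) < d := by exact_mod_cast hd
  by_cases ht : t = 0
  · subst ht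
    have : ∀ θ : Stiefel d k, Phi Λ (mm Λ (‖(0 : EE k)‖ / √d)) (vth 0 θ) = 0 := by
      intro θ
      simp [Phi, vth, Fc, Fs, mm]
    simp_rw [this]; simp
  have mPhi := measurable_Phi Λ (mm Λ (‖t‖ / √d))
  have hbd := Phi_bdd Λ (mm Λ (‖t‖ / √d)) (abs_mm_le Λ _)
  have h1 : ∫ θ, Phi Λ (mm Λ (‖t‖ / √d)) (vth t θ) ∂μ =
      ∫ g, Phi Λ (mm Λ (‖t‖ / √d)) ((‖t‖ * ‖g‖⁻¹) • g) ∂(gam d) := by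
    rw [← integral_map (f := Phi Λ (mm Λ (‖t‖ / √d))) (measurable_vth' t).aemeasurable mPhi.aestronglyMeasurable,
      haar_law hd μ hμ t ht, sphG, integral_map (Measurable.aemeasurable (by fun_prop)) mPhi.aestronglyMeasurable]
  rw [h1]
  set a := ‖t‖ / √d with ha
  have ha2 : a^2 = ‖t‖^2 / d := by rw [ha, div_pow, Real.sq_sqrt hd'.le]
  have hpt : ∀ g : EE d, Phi Λ (mm Λ a) ((‖t‖ * ‖g‖⁻¹) • g) ≤
      2 * ((Fc Λ (a • g) - mm Λ a)^2 + Fs Λ (a • g)^2) + (4 * B * ‖t‖^2 / d^2) * (‖g‖^2 - d)^2 := by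
    intro g
    have hl := Fcs_lip Λ hX hB0 hB ((‖t‖ * ‖g‖⁻¹) • g) (a • g)
    have hn : ‖(‖t‖ * ‖g‖⁻¹) • g - a • g‖^2 ≤ ‖t‖^2 / d^2 * (‖g‖^2 - d)^2 := by
      rw [← sub_smul, norm_smul, mul_pow, Real.norm_eq_abs, sq_abs]
      by_cases hg : ‖g‖ = 0
      · rw [hg]; simp; positivity
      have e : (‖t‖ * ‖g‖⁻¹ - a)^2 * ‖g‖^2 = ‖t‖^2 * (1 - ‖g‖/√d)^2 := by
        rw [ha]; field_simp
      have e2 : ‖t‖^2 / d^2 * (‖g‖^2 - d)^2 = ‖t‖^2 * ((1 - ‖g‖/√d) * (1 + ‖g‖/√d))^2 := by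
        have : (1 - ‖g‖/√d) * (1 + ‖g‖/√d) = 1 - ‖g‖^2 / d := by
          have : (‖g‖/√d)^2 = ‖g‖^2/d := by rw [div_pow, Real.sq_sqrt hd'.le]
          linear_combination -this
        rw [this]; field_simp; ring
      rw [e, e2, mul_pow]
      have : 0 ≤ ‖g‖/√d := by positivity
      have h3 : 1 ≤ (1 + ‖g‖/√d)^2 := by nlinarith
      have h4 : 0 ≤ (1 - ‖g‖/√d)^2 := sq_nonneg _
      gcongr
      nlinarith
    have hn' : B * ‖(‖t‖ * ‖g‖⁻¹) • g - a • g‖^2 ≤ B * (‖t‖^2 / d^2 * (‖g‖^2 - d)^2) := by gcongr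
    unfold Phi
    set u := (‖t‖ * ‖g‖⁻¹) • g
    set w := a • g
    have q1 : (Fc Λ u - mm Λ a)^2 ≤ 2 * (Fc Λ w - mm Λ a)^2 + 2 * (Fc Λ u - Fc Λ w)^2 := by
      nlinarith [sq_nonneg (Fc Λ w - mm Λ a - (Fc Λ u - Fc Λ w))]
    have q2 : (Fs Λ u)^2 ≤ 2 * (Fs Λ w)^2 + 2 * (Fs Λ u - Fs Λ w)^2 := by
      nlinarith [sq_nonneg (Fs Λ w - (Fs Λ u - Fs Λ w))]
    have e5 : (4 * B * ‖t‖^2 / d^2) * (‖g‖^2 - d)^2 = 4 * (B * (‖t‖^2 / d^2 * (‖g‖^2 - d)^2)) := by ring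
    rw [e5]
    linarith [hl.1, hl.2]
  have i1 : Integrable (fun g => Phi Λ (mm Λ a) ((‖t‖ * ‖g‖⁻¹) • g)) (gam d) :=
    integrable_of_meas_bdd _ (mPhi.comp (by fun_prop)) 5 (fun g => by
      rw [abs_of_nonneg (hbd _).1]; exact (hbd _).2)
  have i2 : Integrable (fun g => (Fc Λ (a • g) - mm Λ a)^2 + Fs Λ (a • g)^2) (gam d) :=
    integrable_of_meas_bdd _ (mPhi.comp (g := Phi Λ (mm Λ a)) (f := fun g => a • g) (by fun_prop)) 5 (fun g => by
      have := hbd (a • g)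
      unfold Phi at this
      rw [abs_of_nonneg this.1]; exact this.2)
  obtain ⟨i3, e3⟩ := gam_fourth d
  have := integral_mono i1 ((i2.const_mul 2).add (i3.const_mul (4 * B * ‖t‖^2 / d^2))) hpt
  refine this.trans ?_
  rw [integral_add' (i2.const_mul 2) (i3.const_mul _), integral_const_mul, integral_const_mul, e3]
  have hg := gauss_var Λ hX hB0 hB a
  rw [ha2] at hg
  have : 4 * B * ‖t‖ ^ 2 / d ^ 2 * (VV * d) = 4 * VV * (B * ‖t‖^2 / d) := by field_simp
  rw [this]
  have e6 : 2 * (‖t‖^2/d) * B = 2 * (B * ‖t‖^2 / d) := by ring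
  rw [e6] at hg
  linarith

end

def gsd (k : ℕ) (s : ℝ) (z : EE k) : ℝ := (2 * π * s^2) ^ (-(k:ℝ)/2) * Real.exp (-(1/(2*s^2)) * ‖z‖^2)

lemma gsd_nonneg (k : ℕ) (s : ℝ) (z : EE k) : 0 ≤ gsd k s z := by unfold gsd; positivity

lemma continuous_gsd (k : ℕ) (s : ℝ) : Continuous (gsd k s) := by unfold gsd; fun_prop

lemma gsd_neg (k : ℕ) (s : ℝ) (z : EE k) : gsd k s (-z) = gsd k s z := by unfold gsd; simp

lemma integrable_exp_sq (k : ℕ) {b : ℝ} (hb : 0 < b) :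
    Integrable (fun z : EE k => Real.exp (-b * ‖z‖^2)) := by
  by_contra h
  have h1 := GaussianFourier.integral_rexp_neg_mul_sq_norm (V := EE k) hb
  rw [integral_undef h] at h1
  have : 0 < (π / b) ^ ((Module.finrank ℝ (EE k) : ℝ) / 2) := by positivity
  linarith

lemma integrable_gsd (k : ℕ) {s : ℝ} (hs : 0 < s) : Integrable (gsd k s) :=
  (integrable_exp_sq k (b := 1/(2*s^2)) (by positivity)).const_mul _

lemma gsd_const (k : ℕ) {s : ℝ} (hs : 0 < s) :
    (2 * π * s^2) ^ (-(k:ℝ)/2) * (π / (1/(2*s^2))) ^ ((k:ℝ)/2) = 1 := by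
  have : π / (1/(2*s^2)) = 2 * π * s^2 := by field_simp
  rw [this, ← Real.rpow_add (by positivity)]
  simp [neg_div]

lemma integral_gsd (k : ℕ) {s : ℝ} (hs : 0 < s) : ∫ z, gsd k s z = 1 := by
  unfold gsd
  rw [integral_const_mul, GaussianFourier.integral_rexp_neg_mul_sq_norm (by positivity)]
  simp only [finrank_euclideanSpace, Fintype.card_fin]
  exact gsd_const k hs

lemma gam_density (k : ℕ) {s : ℝ} (hs : 0 < s) :
    (gam k).map (fun z => s • z) = volume.withDensity (fun z => ENNReal.ofReal (gsd k s z)) := by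
  have hf : IsFiniteMeasure (volume.withDensity (fun z => ENNReal.ofReal (gsd k s z))) :=
    isFiniteMeasure_withDensity_ofReal (integrable_gsd k hs).2
  have hp : IsProbabilityMeasure ((gam k).map (fun z => s • z)) :=
    Measure.isProbabilityMeasure_map (Measurable.aemeasurable (by fun_prop))
  refine Measure.ext_of_charFun (funext fun t => ?_)
  rw [charFun_apply, charFun_apply, integral_map (Measurable.aemeasurable (by fun_prop))
    (Measurable.aestronglyMeasurable (by fun_prop))]
  have h1 : ∀ z : EE k, ⟪s • z, t⟫ = ⟪z, s • t⟫ := fun z => by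
    rw [real_inner_smul_left, real_inner_smul_right]
  simp_rw [h1]
  rw [gam_charFun]
  rw [integral_withDensity_eq_integral_toReal_smul
    ((continuous_gsd k s).measurable.ennreal_ofReal) (by simp)]
  have h2 := GaussianFourier.integral_cexp_neg_mul_sq_norm_add (V := EE k)
    (b := ((1/(2*s^2) : ℝ) : ℂ)) (by rw [Complex.ofReal_re]; positivity) Complex.I t
  have h3 : ∀ z : EE k, (ENNReal.ofReal (gsd k s z)).toReal • Complex.exp (⟪z, t⟫ * Complex.I)
      = (((2 * π * s^2) ^ (-(k:ℝ)/2) : ℝ) : ℂ) *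
        Complex.exp (-((1/(2*s^2) : ℝ) : ℂ) * ‖z‖^2 + Complex.I * ⟪t, z⟫) := by
    intro z
    rw [ENNReal.toReal_ofReal (gsd_nonneg _ _ _), Complex.exp_add, Complex.real_smul, gsd, real_inner_comm]
    push_cast
    rw [mul_comm Complex.I]; ring
  simp_rw [h3]
  rw [integral_const_mul, h2]
  have h4 : (((π : ℝ) : ℂ) / ((1/(2*s^2) : ℝ) : ℂ)) ^ ((Module.finrank ℝ (EE k) : ℂ) / 2)
     = (((π / (1/(2*s^2))) ^ ((k:ℝ)/2) : ℝ) : ℂ) := by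
    rw [Complex.ofReal_cpow (by positivity)]; simp
  rw [h4, ← mul_assoc, ← Complex.ofReal_mul, gsd_const k hs]
  simp only [Complex.ofReal_one, one_mul, Complex.I_sq]
  rw [norm_smul, mul_pow, Real.norm_eq_abs, sq_abs]
  push_cast
  congr 1
  have : (s:ℂ) ≠ 0 := by exact_mod_cast hs.ne'
  field_simp
  norm_num

lemma gam_int (k : ℕ) {s : ℝ} (hs : 0 < s) (F : EE k → ℝ) :
    ∫ z, F (s • z) ∂(gam k) = ∫ z, gsd k s z * F z := by
  have e : MeasurableEmbedding (fun z : EE k => s • z) :=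
    (Homeomorph.smulOfNeZero s hs.ne').measurableEmbedding
  rw [← e.integral_map, gam_density k hs, integral_withDensity_eq_integral_toReal_smul
    ((continuous_gsd k s).measurable.ennreal_ofReal) (by simp)]
  refine integral_congr_ae (ae_of_all _ fun z => ?_)
  simp [ENNReal.toReal_ofReal (gsd_nonneg _ _ _)]

def KK (k : ℕ) (s : ℝ) : ℝ := (2 * π * s^2) ^ (-(k:ℝ)) * (π * s^2) ^ ((k:ℝ)/2)

lemma gsd_conv (k : ℕ) {s : ℝ} (hs : 0 < s) (x y : EE k) :
    ∫ z, gsd k s (z - x) * gsd k s (z - y) = KK k s * ∫ g, Real.cos ⟪g, (1/(√2 * s)) • (x - y)⟫ ∂(gam k) := by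
  rw [gam_cos]
  have h1 : ∀ z : EE k, gsd k s (z - x) * gsd k s (z - y) =
     ((2 * π * s^2) ^ (-(k:ℝ)) * Real.exp (-‖x-y‖^2/(4*s^2))) * Real.exp (-(1/s^2) * ‖z - (1/2:ℝ) • (x+y)‖^2) := by
    intro z
    have hp := parallelogram_law_with_norm ℝ (z - x) (z - y)
    have e1 : z - x + (z - y) = (2:ℝ) • (z - (1/2:ℝ) • (x+y)) := by module
    have e2 : z - x - (z - y) = -(x - y) := by module
    rw [e1, e2, norm_neg, norm_smul] at hp
    rw [Real.norm_eq_abs, abs_two] at hp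
    have e3 : (2 * π * s^2) ^ (-(k:ℝ)/2) * (2 * π * s^2) ^ (-(k:ℝ)/2) = (2 * π * s^2) ^ (-(k:ℝ)) := by
      rw [← Real.rpow_add (by positivity)]; congr 1; ring
    have e4 : Real.exp (-(1/(2*s^2)) * ‖z-x‖^2) * Real.exp (-(1/(2*s^2)) * ‖z-y‖^2) =
        Real.exp (-‖x-y‖^2/(4*s^2)) * Real.exp (-(1/s^2) * ‖z - (1/2:ℝ) • (x+y)‖^2) := by
      rw [← Real.exp_add, ← Real.exp_add]
      congr 1
      generalize ‖z - (1/2:ℝ) • (x+y)‖ = u at *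
      field_simp
      linarith
    unfold gsd
    rw [mul_mul_mul_comm, e3, e4]; ring
  simp_rw [h1]
  rw [integral_const_mul, integral_sub_right_eq_self (fun z : EE k => Real.exp (-(1/s^2) * ‖z‖^2)),
    GaussianFourier.integral_rexp_neg_mul_sq_norm (by positivity)]
  simp only [finrank_euclideanSpace, Fintype.card_fin]
  have : π / (1/s^2) = π * s^2 := by field_simp
  rw [this, KK, norm_smul, mul_pow, Real.norm_eq_abs, sq_abs]
  have : -(‖x-y‖^2)/(4*s^2) = -((1/(√2*s))^2 * ‖x-y‖^2)/2 := by
    rw [div_pow, mul_pow, Real.sq_sqrt (by norm_num)]; field_simp; norm_num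
  rw [this]; ring

/-- Gaussian smoothing. -/
def TT {k : ℕ} (s : ℝ) (f : EE k → ℝ) (x : EE k) : ℝ := ∫ z, f (x + s • z) ∂(gam k)

def avg {k : ℕ} (p : Measure (EE k)) (s : ℝ) (z : EE k) : ℝ := ∫ x, gsd k s (z - x) ∂p

lemma gsd_le (k : ℕ) (s : ℝ) (z : EE k) : gsd k s z ≤ (2 * π * s^2) ^ (-(k:ℝ)/2) := by
  unfold gsd
  refine mul_le_of_le_one_right (by positivity) (Real.exp_le_one_iff.2 ?_)
  have : 0 ≤ 1/(2*s^2) * ‖z‖^2 := by positivity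
  linarith

lemma TT_eq {k : ℕ} {s : ℝ} (hs : 0 < s) (f : EE k → ℝ) (x : EE k) :
    TT s f x = ∫ z, gsd k s (z - x) * f z := by
  rw [← integral_add_right_eq_self (fun z => gsd k s (z - x) * f z) x, TT, gam_int k hs (fun z => f (x + z))]
  refine integral_congr_ae (ae_of_all _ fun z => ?_)
  simp [add_comm]

section
variable {k : ℕ} (p q : Measure (EE k)) [IsProbabilityMeasure p] [IsProbabilityMeasure q]

lemma integrable_gsd_prod {s : ℝ} (hs : 0 < s) :
    Integrable (fun w : EE k × EE k => gsd k s (w.2 - w.1)) (p.prod volume) := by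
  have hc := continuous_gsd k s
  rw [integrable_prod_iff (Continuous.aestronglyMeasurable (by fun_prop))]
  refine ⟨ae_of_all _ fun x => (integrable_gsd k hs).comp_sub_right x, ?_⟩
  have : ∀ x : EE k, ∫ y, ‖gsd k s (y - x)‖ = 1 := fun x => by
    simp_rw [Real.norm_eq_abs, abs_of_nonneg (gsd_nonneg k s _)]
    rw [integral_sub_right_eq_self (gsd k s), integral_gsd k hs]
  simp only [this]
  exact integrable_const _

lemma integrable_avg {s : ℝ} (hs : 0 < s) : Integrable (avg p s) :=
  (integrable_gsd_prod p hs).integral_prod_right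

lemma avg_nonneg (s : ℝ) (z : EE k) : 0 ≤ avg p s z := integral_nonneg fun _ => gsd_nonneg _ _ _

lemma avg_le (s : ℝ) (z : EE k) : avg p s z ≤ (2 * π * s^2) ^ (-(k:ℝ)/2) := by
  have hc := continuous_gsd k s
  have : avg p s z ≤ ∫ x : EE k, (2 * π * s^2) ^ (-(k:ℝ)/2) ∂p := by
    refine integral_mono ?_ (integrable_const _) (fun x => gsd_le k s _)
    refine integrable_of_meas_bdd p (by fun_prop) ((2 * π * s^2) ^ (-(k:ℝ)/2)) (fun x => ?_)
    rw [abs_of_nonneg (gsd_nonneg _ _ _)]; exact gsd_le k s _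
  simpa using this

lemma integral_TT {s : ℝ} (hs : 0 < s) {h : EE k → ℝ} (hm : Measurable h) (M : ℝ) (hM : ∀ x, |h x| ≤ M) :
    ∫ x, TT s h x ∂p = ∫ z, h z * avg p s z := by
  simp_rw [TT_eq hs]
  rw [integral_integral_swap]
  · refine integral_congr_ae (ae_of_all _ fun z => ?_)
    simp only [avg]
    rw [integral_mul_const, mul_comm]
  · refine (integrable_gsd_prod p hs).mul_bdd (c := M) ?_ ?_
    · exact (hm.comp measurable_snd).aestronglyMeasurable
    · exact ae_of_all _ fun w => hM _

lemma avg_mul_integrable {s : ℝ} (hs : 0 < s) : Integrable (fun z => avg p s z * avg q s z) := by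
  refine (integrable_avg p hs).mul_bdd (c := (2 * π * s^2) ^ (-(k:ℝ)/2)) (integrable_avg q hs).1 ?_
  refine ae_of_all _ fun z => ?_
  rw [Real.norm_eq_abs, abs_of_nonneg (avg_nonneg q s z)]
  exact avg_le q s z

lemma Fcs_mul (v : EE k) : Fc p v * Fc q v + Fs p v * Fs q v = ∫ w, Real.cos ⟪w.1 - w.2, v⟫ ∂(p.prod q) := by
  have h1 : ∀ w : EE k × EE k, Real.cos ⟪w.1 - w.2, v⟫ =
      Real.cos ⟪w.1, v⟫ * Real.cos ⟪w.2, v⟫ + Real.sin ⟪w.1, v⟫ * Real.sin ⟪w.2, v⟫ := by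
    intro w; rw [inner_sub_left, Real.cos_sub]
  simp_rw [h1]
  rw [integral_add, integral_prod_mul (fun x => Real.cos ⟪x, v⟫) (fun x => Real.cos ⟪x, v⟫),
    integral_prod_mul (fun x => Real.sin ⟪x, v⟫) (fun x => Real.sin ⟪x, v⟫)]
  · rfl
  · exact (integrable_cos_inner p v).mul_prod (integrable_cos_inner q v)
  · exact (integrable_sin_inner p v).mul_prod (integrable_sin_inner q v)

lemma avg_mul {s : ℝ} (hs : 0 < s) : ∫ z, avg p s z * avg q s z =
    KK k s * ∫ g, (Fc p ((1/(√2 * s)) • g) * Fc q ((1/(√2 * s)) • g)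
      + Fs p ((1/(√2 * s)) • g) * Fs q ((1/(√2 * s)) • g)) ∂(gam k) := by
  have hc := continuous_gsd k s
  have h1 : ∀ z, avg p s z * avg q s z = ∫ w, gsd k s (z - w.1) * gsd k s (z - w.2) ∂(p.prod q) := by
    intro z
    rw [integral_prod_mul (fun x => gsd k s (z - x)) (fun x => gsd k s (z - x))]; rfl
  have hcos : Integrable (fun u : (EE k × EE k) × EE k => Real.cos ⟪u.2, (1/(√2 * s)) • (u.1.1 - u.1.2)⟫)
      ((p.prod q).prod (gam k)) :=
    integrable_of_meas_bdd _ (by fun_prop) 1 (fun u => abs_cos_le_one _)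
  simp_rw [h1, Fcs_mul]
  rw [integral_integral_swap]
  · simp_rw [gsd_conv k hs]
    rw [integral_const_mul, integral_integral_swap hcos]
    congr 1
    refine integral_congr_ae (ae_of_all _ fun g => ?_)
    refine integral_congr_ae (ae_of_all _ fun w => ?_)
    simp only
    rw [real_inner_smul_right, real_inner_smul_right, real_inner_comm]
  · have hmeas : AEStronglyMeasurable (fun u : EE k × (EE k × EE k) => gsd k s (u.1 - u.2.1) * gsd k s (u.1 - u.2.2))
      (volume.prod (p.prod q)) := Continuous.aestronglyMeasurable (by fun_prop)
    change Integrable (fun u : EE k × (EE k × EE k) => gsd k s (u.1 - u.2.1) * gsd k s (u.1 - u.2.2)) _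
    rw [integrable_prod_iff' hmeas]
    constructor
    · refine ae_of_all _ fun w => ?_
      refine ((integrable_gsd k hs).comp_sub_right w.1).mul_bdd (c := (2 * π * s^2) ^ (-(k:ℝ)/2))
        (Continuous.aestronglyMeasurable (by fun_prop)) (ae_of_all _ fun z => ?_)
      rw [Real.norm_eq_abs, abs_of_nonneg (gsd_nonneg k s _)]
      exact gsd_le k s _
    · simp_rw [norm_mul, Real.norm_eq_abs, abs_of_nonneg (gsd_nonneg k s _), gsd_conv k hs]
      exact hcos.integral_prod_left.const_mul _

/-- The squared `L²` norm of the difference of the smoothed densities. -/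
def NN (s : ℝ) : ℝ := KK k s * ∫ g, ((Fc p ((1/(√2 * s)) • g) - Fc q ((1/(√2 * s)) • g))^2
      + (Fs p ((1/(√2 * s)) • g) - Fs q ((1/(√2 * s)) • g))^2) ∂(gam k)

lemma integrable_FF (c : ℝ) : Integrable (fun g => Fc p (c • g) * Fc q (c • g)
      + Fs p (c • g) * Fs q (c • g)) (gam k) := by
  have m1 := measurable_Fc p
  have m2 := measurable_Fc q
  have m3 := measurable_Fs p
  have m4 := measurable_Fs q
  refine integrable_of_meas_bdd _ (by fun_prop) 2 (fun g => ?_)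
  have a1 := abs_Fc_le p (c • g)
  have a2 := abs_Fc_le q (c • g)
  have a3 := abs_Fs_le p (c • g)
  have a4 := abs_Fs_le q (c • g)
  refine (abs_add_le _ _).trans ?_
  rw [abs_mul, abs_mul]
  have b1 := mul_le_mul a1 a2 (abs_nonneg _) zero_le_one
  have b2 := mul_le_mul a3 a4 (abs_nonneg _) zero_le_one
  linarith

lemma int_three {ν : Measure (EE k)} {a b c : EE k → ℝ} (ha : Integrable a ν) (hb : Integrable b ν)
    (hc : Integrable c ν) : ∫ z, (a z - 2 * b z + c z) ∂ν = ∫ z, a z ∂ν - 2 * ∫ z, b z ∂ν + ∫ z, c z ∂ν := by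
  have h1 : Integrable (fun z => a z - 2 * b z) ν := ha.sub (hb.const_mul 2)
  rw [integral_add h1 hc, integral_sub ha (hb.const_mul 2), integral_const_mul]

lemma integral_rr {s : ℝ} (hs : 0 < s) : ∫ z, (avg p s z - avg q s z)^2 = NN p q s := by
  have h : ∀ z, (avg p s z - avg q s z)^2 = avg p s z * avg p s z - 2 * (avg p s z * avg q s z)
    + avg q s z * avg q s z := fun z => by ring
  have i1 := avg_mul_integrable p p hs
  have i2 := avg_mul_integrable p q hs
  have i3 := avg_mul_integrable q q hs
  simp_rw [h]
  rw [int_three i1 i2 i3,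
    avg_mul p p hs, avg_mul p q hs, avg_mul q q hs, NN]
  have j1 := integrable_FF p p (1/(√2 * s))
  have j2 := integrable_FF p q (1/(√2 * s))
  have j3 := integrable_FF q q (1/(√2 * s))
  have e : ∀ g : EE k, ((Fc p ((1/(√2 * s)) • g) - Fc q ((1/(√2 * s)) • g))^2
      + (Fs p ((1/(√2 * s)) • g) - Fs q ((1/(√2 * s)) • g))^2) =
      (Fc p ((1/(√2 * s)) • g) * Fc p ((1/(√2 * s)) • g)
      + Fs p ((1/(√2 * s)) • g) * Fs p ((1/(√2 * s)) • g)) -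
      2 * (Fc p ((1/(√2 * s)) • g) * Fc q ((1/(√2 * s)) • g)
      + Fs p ((1/(√2 * s)) • g) * Fs q ((1/(√2 * s)) • g)) +
      (Fc q ((1/(√2 * s)) • g) * Fc q ((1/(√2 * s)) • g)
      + Fs q ((1/(√2 * s)) • g) * Fs q ((1/(√2 * s)) • g)) := fun g => by ring
  simp_rw [e]
  rw [int_three j1 j2 j3]
  ring

end

lemma gam_integrable_norm (k : ℕ) : Integrable (fun g : EE k => ‖g‖) (gam k) := by
  refine ((gam_integrable_normsq k).add (integrable_const 1)).mono' (by fun_prop) (ae_of_all _ fun z => ?_)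
  simp only [norm_norm, Pi.add_apply]
  nlinarith [sq_nonneg (‖z‖ - 1), norm_nonneg z]

lemma gam_norm_le (k : ℕ) : ∫ g, ‖g‖ ∂(gam k) ≤ √k := by
  have h := sq_integral_le (gam k) (f := fun g : EE k => ‖g‖) (by fun_prop) (gam_integrable_normsq k)
  rw [gam_normsq] at h
  exact Real.le_sqrt_of_sq_le h

lemma norm_add_sq_le' {k : ℕ} (x y : EE k) : ‖x + y‖^2 ≤ 2 * ‖x‖^2 + 2 * ‖y‖^2 := by
  have h := norm_add_le x y
  have := norm_nonneg (x + y)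
  nlinarith [sq_nonneg (‖x‖ - ‖y‖), norm_nonneg x, norm_nonneg y]

lemma tail_bound {k : ℕ} (p : Measure (EE k)) [IsProbabilityMeasure p] {s : ℝ} (hs : 0 < s) {R : ℝ} (hR : 0 < R)
    (hp : Integrable (fun x => ‖x‖^2) p) :
    ∫ z, (Metric.closedBall (0 : EE k) R)ᶜ.indicator 1 z * avg p s z ≤
      (2 * ∫ x, ‖x‖^2 ∂p + 2 * s^2 * k) / R^2 := by
  have hms : MeasurableSet (Metric.closedBall (0 : EE k) R)ᶜ := Metric.isClosed_closedBall.measurableSet.compl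
  have hh : Measurable ((Metric.closedBall (0 : EE k) R)ᶜ.indicator (1 : EE k → ℝ)) :=
    measurable_one.indicator hms
  have h0 : ∀ z : EE k, 0 ≤ (Metric.closedBall (0 : EE k) R)ᶜ.indicator (1 : EE k → ℝ) z :=
    fun z => Set.indicator_nonneg (fun _ _ => zero_le_one) z
  have h1 : ∀ z : EE k, (Metric.closedBall (0 : EE k) R)ᶜ.indicator (1 : EE k → ℝ) z ≤ ‖z‖^2/R^2 := by
    intro z
    by_cases hz : z ∈ (Metric.closedBall (0 : EE k) R)ᶜ
    · rw [Set.indicator_of_mem hz]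
      simp only [Set.mem_compl_iff, mem_closedBall_zero_iff, not_le] at hz
      rw [Pi.one_apply, one_le_div (by positivity)]
      gcongr
    · rw [Set.indicator_of_notMem hz]; positivity
  have hle1 : ∀ z : EE k, |(Metric.closedBall (0 : EE k) R)ᶜ.indicator (1 : EE k → ℝ) z| ≤ 1 := by
    intro z
    rw [abs_of_nonneg (h0 z)]
    exact Set.indicator_le_self' (fun _ _ => zero_le_one) z
  rw [← integral_TT p hs hh 1 hle1]
  have hT : ∀ x : EE k, TT s ((Metric.closedBall (0 : EE k) R)ᶜ.indicator (1 : EE k → ℝ)) x ≤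
      (2 * ‖x‖^2 + 2 * s^2 * k) / R^2 := by
    intro x
    have hi : Integrable (fun z : EE k => (2 * ‖x‖^2 + 2 * s^2 * ‖z‖^2) / R^2) (gam k) :=
      ((integrable_const _).add ((gam_integrable_normsq k).const_mul _)).div_const _
    have : TT s ((Metric.closedBall (0 : EE k) R)ᶜ.indicator (1 : EE k → ℝ)) x ≤
        ∫ z, (2 * ‖x‖^2 + 2 * s^2 * ‖z‖^2) / R^2 ∂(gam k) := by
      refine integral_mono_of_nonneg (ae_of_all _ fun z => h0 _) hi (ae_of_all _ fun z => ?_)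
      refine (h1 _).trans ?_
      have := norm_add_sq_le' x (s • z)
      rw [norm_smul, mul_pow, Real.norm_eq_abs, sq_abs] at this
      simp only
      gcongr
      linarith
    refine this.trans (le_of_eq ?_)
    rw [integral_div, integral_add (integrable_const _) ((gam_integrable_normsq k).const_mul _),
      integral_const_mul (2 * s^2), gam_normsq]
    simp
  have hi : Integrable (fun x : EE k => (2 * ‖x‖^2 + 2 * s^2 * k) / R^2) p :=
      ((hp.const_mul 2).add (integrable_const _)).div_const _
  refine (integral_mono_of_nonneg (ae_of_all _ fun x => ?_) hi (ae_of_all _ hT)).trans (le_of_eq ?_)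
  · exact integral_nonneg fun z => h0 _
  · rw [integral_div, integral_add (hp.const_mul 2) (integrable_const _), integral_const_mul]
    simp

lemma key {k : ℕ} (p q : Measure (EE k)) [IsProbabilityMeasure p] [IsProbabilityMeasure q]
    {s : ℝ} (hs : 0 < s) {h : EE k → ℝ} (hm : Measurable h) {M : ℝ} (hM0 : 0 ≤ M) (hM : ∀ x, |h x| ≤ M)
    {R : ℝ} (hR : 0 < R) {η V : ℝ} (hη : 0 < η) (hV : 0 < V)
    (hvol : volume.real (Metric.closedBall (0 : EE k) R) ≤ V)
    (hp : Integrable (fun x => ‖x‖^2) p) (hq : Integrable (fun x => ‖x‖^2) q) :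
    |∫ x, TT s h x ∂p - ∫ x, TT s h x ∂q| ≤ η + M^2 * V / (4 * η) * NN p q s
      + M * ((2 * ∫ x, ‖x‖^2 ∂p + 2 * s^2 * k) / R^2 + (2 * ∫ x, ‖x‖^2 ∂q + 2 * s^2 * k) / R^2) := by
  have hmb : MeasurableSet (Metric.closedBall (0 : EE k) R) := Metric.isClosed_closedBall.measurableSet
  have ip := integrable_avg p hs
  have iq := integrable_avg q hs
  have hbd : ∀ᵐ z : EE k, ‖h z‖ ≤ M := ae_of_all _ hM
  have ihp : Integrable (fun z => h z * avg p s z) := ip.bdd_mul hm.aestronglyMeasurable hbd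
  have ihq : Integrable (fun z => h z * avg q s z) := iq.bdd_mul hm.aestronglyMeasurable hbd
  rw [integral_TT p hs hm M hM, integral_TT q hs hm M hM, ← integral_sub ihp ihq, ← integral_rr p q hs]
  have ir : Integrable (fun z => (avg p s z - avg q s z)^2) := by
    have i1 := avg_mul_integrable p p hs
    have i2 := avg_mul_integrable p q hs
    have i3 := avg_mul_integrable q q hs
    refine ((i1.sub (i2.const_mul 2)).add i3).congr (ae_of_all _ fun z => ?_)
    simp only [Pi.add_apply, Pi.sub_apply]; ring
  set c := (Metric.closedBall (0 : EE k) R)ᶜ.indicator (1 : EE k → ℝ) with hc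
  set b := (Metric.closedBall (0 : EE k) R).indicator (1 : EE k → ℝ) with hb
  have hcm : Measurable c := measurable_one.indicator hmb.compl
  have hcb : ∀ᵐ z : EE k, ‖c z‖ ≤ 1 := ae_of_all _ fun z => by
    by_cases hz : z ∈ (Metric.closedBall (0 : EE k) R)ᶜ
    · rw [hc, Set.indicator_of_mem hz]; simp
    · rw [hc, Set.indicator_of_notMem hz]; simp
  have icp : Integrable (fun z => c z * avg p s z) := ip.bdd_mul hcm.aestronglyMeasurable hcb
  have icq : Integrable (fun z => c z * avg q s z) := iq.bdd_mul hcm.aestronglyMeasurable hcb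
  have ib : Integrable b := by
    rw [hb]
    exact (integrable_indicator_iff hmb).2 (by
      have : IntegrableOn (fun _ : EE k => (1:ℝ)) (Metric.closedBall (0 : EE k) R) :=
        integrableOn_const (by exact measure_closedBall_lt_top.ne)
      exact this)
  have ibv : ∫ z, b z = volume.real (Metric.closedBall (0 : EE k) R) := by
    rw [hb, integral_indicator_one hmb]
  have hpt : ∀ z, |h z * avg p s z - h z * avg q s z| ≤
      (η / V) * b z + M^2 * V / (4 * η) * (avg p s z - avg q s z)^2 + M * (c z * avg p s z + c z * avg q s z) := by
    intro z
    have ap := avg_nonneg p s z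
    have aq := avg_nonneg q s z
    have hh : |h z * avg p s z - h z * avg q s z| ≤ M * |avg p s z - avg q s z| := by
      rw [← mul_sub, abs_mul]; gcongr; exact hM z
    by_cases hz : z ∈ Metric.closedBall (0 : EE k) R
    · have hb1 : b z = 1 := by rw [hb, Set.indicator_of_mem hz]; rfl
      have hc1 : c z = 0 := by rw [hc, Set.indicator_of_notMem (by simpa using hz)]
      rw [hb1, hc1]
      refine hh.trans ?_
      have : (η / V) * 1 + M^2 * V / (4 * η) * (avg p s z - avg q s z)^2 - M * |avg p s z - avg q s z|
        = (η / V) * (1 - M * V / (2 * η) * |avg p s z - avg q s z|)^2 := by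
        have e : (1 - M * V / (2 * η) * |avg p s z - avg q s z|)^2 = 1 - 2 * (M * V / (2 * η)) * |avg p s z - avg q s z| +
          (M * V / (2 * η))^2 * (avg p s z - avg q s z)^2 := by rw [← sq_abs (avg p s z - avg q s z)]; ring
        rw [e]; field_simp; ring
      have h2 : 0 ≤ (η / V) * (1 - M * V / (2 * η) * |avg p s z - avg q s z|)^2 := by positivity
      linarith
    · have hb1 : b z = 0 := by rw [hb, Set.indicator_of_notMem hz]
      have hc1 : c z = 1 := by rw [hc, Set.indicator_of_mem (by simpa using hz)]; rfl
      rw [hb1, hc1]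
      refine hh.trans ?_
      have h1 : |avg p s z - avg q s z| ≤ avg p s z + avg q s z := by
        rw [abs_le]; constructor <;> linarith
      have h2 : 0 ≤ M^2 * V / (4 * η) * (avg p s z - avg q s z)^2 := by positivity
      have h3 := mul_le_mul_of_nonneg_left h1 hM0
      linarith
  have j1 : Integrable (fun z => (η / V) * b z) := ib.const_mul _
  have j2 : Integrable (fun z => M^2 * V / (4 * η) * (avg p s z - avg q s z)^2) := ir.const_mul _
  have j3 : Integrable (fun z => M * (c z * avg p s z + c z * avg q s z)) := (icp.add icq).const_mul _
  have j12 : Integrable (fun z => (η / V) * b z + M^2 * V / (4 * η) * (avg p s z - avg q s z)^2) := j1.add j2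
  refine (abs_integral_le_integral_abs).trans ?_
  refine (integral_mono (ihp.sub ihq).abs (j12.add j3) hpt).trans ?_
  rw [integral_add' j12 j3, integral_add j1 j2, integral_const_mul, integral_const_mul, integral_const_mul,
      integral_add icp icq, ibv]
  have t1 := tail_bound p hs hR hp
  have t2 := tail_bound q hs hR hq
  have v1 : η / V * volume.real (Metric.closedBall (0 : EE k) R) ≤ η := by
    rw [div_mul_eq_mul_div, div_le_iff₀ hV]; gcongr
  gcongr

lemma vol_bound {k : ℕ} (hk : 0 < k) {R : ℝ} (hR : 0 < R) :
    volume.real (Metric.closedBall (0 : EE k) R) ≤ Real.exp ((k:ℝ)/2) * (2 * π * R^2 / k) ^ ((k:ℝ)/2) := by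
  have hmb : MeasurableSet (Metric.closedBall (0 : EE k) R) := Metric.isClosed_closedBall.measurableSet
  rw [← integral_indicator_one hmb]
  have hk' : (0:ℝ) < k := by exact_mod_cast hk
  have hb : 0 < (k:ℝ)/(2*R^2) := by positivity
  have : π / ((k:ℝ)/(2*R^2)) = 2 * π * R^2 / k := by field_simp
  have h2 := GaussianFourier.integral_rexp_neg_mul_sq_norm (V := EE k) hb
  simp only [finrank_euclideanSpace, Fintype.card_fin] at h2
  rw [← this, ← h2, ← integral_const_mul]
  refine integral_mono_of_nonneg (ae_of_all _ fun z => Set.indicator_nonneg (fun _ _ => zero_le_one) z)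
    ((integrable_exp_sq k hb).const_mul _) (ae_of_all _ fun z => ?_)
  by_cases hz : z ∈ Metric.closedBall (0 : EE k) R
  · simp only [Set.indicator_of_mem hz, Pi.one_apply]
    rw [← Real.exp_add]
    apply Real.one_le_exp
    rw [mem_closedBall_zero_iff] at hz
    have : ‖z‖^2 ≤ R^2 := by gcongr
    have e : (k:ℝ)/2 = (k:ℝ)/(2*R^2) * R^2 := by field_simp
    rw [e]
    nlinarith
  · simp only [Set.indicator_of_notMem hz]; positivity

lemma lip_abs {k : ℕ} {f : EE k → ℝ} (hf : LipschitzWith 1 f) (x y : EE k) : |f x - f y| ≤ ‖x - y‖ := by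
  have := hf.dist_le_mul x y
  rwa [NNReal.coe_one, one_mul, Real.dist_eq, dist_eq_norm] at this

lemma integrable_shift {k : ℕ} {f : EE k → ℝ} (hf : LipschitzWith 1 f) {H : ℝ} (hH : ∀ x, |f x| ≤ H)
    (s : ℝ) (x : EE k) : Integrable (fun z => f (x + s • z)) (gam k) := by
  have := hf.continuous
  exact integrable_of_meas_bdd _ (Continuous.measurable (by fun_prop)) H (fun z => hH _)

lemma TT_lip {k : ℕ} {f : EE k → ℝ} (hf : LipschitzWith 1 f) {H : ℝ} (hH : ∀ x, |f x| ≤ H) (s : ℝ) :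
    LipschitzWith 1 (TT s f) := by
  refine LipschitzWith.of_dist_le_mul fun x y => ?_
  rw [NNReal.coe_one, one_mul, Real.dist_eq, dist_eq_norm, TT, TT,
    ← integral_sub (integrable_shift hf hH s x) (integrable_shift hf hH s y)]
  have := norm_integral_le_of_norm_le_const (μ := gam k) (f := fun z => f (x + s • z) - f (y + s • z))
    (C := ‖x - y‖) (ae_of_all _ fun z => by
      have := lip_abs hf (x + s • z) (y + s • z)
      simpa using this)
  simpa using this

lemma TT_bdd {k : ℕ} {f : EE k → ℝ} {H : ℝ} (hH : ∀ x, |f x| ≤ H) (s : ℝ) (x : EE k) : |TT s f x| ≤ H := by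
  have := norm_integral_le_of_norm_le_const (μ := gam k) (f := fun z => f (x + s • z))
    (C := H) (ae_of_all _ fun z => hH _)
  simpa [TT] using this

lemma TT_close {k : ℕ} {f : EE k → ℝ} (hf : LipschitzWith 1 f) {H : ℝ} (hH : ∀ x, |f x| ≤ H) {s : ℝ} (hs : 0 ≤ s)
    (x : EE k) : |f x - TT s f x| ≤ s * √k := by
  have e : f x - TT s f x = ∫ z, (f x - f (x + s • z)) ∂(gam k) := by
    rw [integral_sub (integrable_const _) (integrable_shift hf hH s x)]; simp [TT]
  rw [e]
  refine (abs_integral_le_integral_abs).trans ?_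
  have : ∫ z, |f x - f (x + s • z)| ∂(gam k) ≤ ∫ z, s * ‖z‖ ∂(gam k) := by
    refine integral_mono_of_nonneg (ae_of_all _ fun z => abs_nonneg _) ((gam_integrable_norm k).const_mul s)
      (ae_of_all _ fun z => ?_)
    refine (lip_abs hf _ _).trans (le_of_eq ?_)
    simp [norm_smul, abs_of_nonneg hs]
  refine this.trans ?_
  rw [integral_const_mul]
  exact mul_le_mul_of_nonneg_left (gam_norm_le k) hs

lemma TT_comm {k : ℕ} {f : EE k → ℝ} (hf : LipschitzWith 1 f) {H : ℝ} (hH : ∀ x, |f x| ≤ H) (s t : ℝ) :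
    TT s (TT t f) = TT t (TT s f) := by
  funext x
  unfold TT
  have := hf.continuous
  rw [integral_integral_swap]
  · refine integral_congr_ae (ae_of_all _ fun z => integral_congr_ae (ae_of_all _ fun w => ?_))
    simp only
    congr 1
    module
  · exact integrable_of_meas_bdd _ (Continuous.measurable (by fun_prop)) H (fun z => hH _)

lemma TT_sub {k : ℕ} {f g : EE k → ℝ} (hf : LipschitzWith 1 f) {H : ℝ} (hH : ∀ x, |f x| ≤ H)
    (hg : LipschitzWith 1 g) (hH' : ∀ x, |g x| ≤ H) (s : ℝ) (x : EE k) :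
    TT s (fun x => f x - g x) x = TT s f x - TT s g x := by
  unfold TT
  rw [integral_sub (integrable_shift hf hH s x) (integrable_shift hg hH' s x)]

def VJ (k : ℕ) (m a S : ℝ) : ℝ := Real.exp ((k:ℝ)/2) * (2 * π * (S * (m^2 + S^2) / a) / k) ^ ((k:ℝ)/2)

section
variable {k : ℕ} (p q : Measure (EE k)) [IsProbabilityMeasure p] [IsProbabilityMeasure q]

def QQ (m a S : ℝ) : ℝ := 9 * a + S^2 * VJ k m a S / a * NN p q (S / √k)

lemma key2 (hk : 0 < k) {m a S : ℝ} (hm : 0 < m) (ha : 0 < a) (hS : 0 < S)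
    {h : EE k → ℝ} (hh : Measurable h) (hM : ∀ x, |h x| ≤ 2 * S)
    (hp : Integrable (fun x => ‖x‖^2) p) (hq : Integrable (fun x => ‖x‖^2) q)
    (hpm : ∫ x, ‖x‖^2 ∂p ≤ m^2) (hqm : ∫ x, ‖x‖^2 ∂q ≤ m^2) :
    |∫ x, TT (S / √k) h x ∂p - ∫ x, TT (S / √k) h x ∂q| ≤ QQ p q m a S := by
  have hk' : (0:ℝ) < k := by exact_mod_cast hk
  have hR2 : 0 < S * (m^2 + S^2) / a := by positivity
  have hR : 0 < √(S * (m^2 + S^2) / a) := Real.sqrt_pos.2 hR2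
  have hv := vol_bound hk hR
  rw [Real.sq_sqrt hR2.le] at hv
  have hV : 0 < VJ k m a S := by unfold VJ; positivity
  have := key p q (s := S / √k) (by positivity) hh (M := 2 * S) (by positivity) hM hR ha hV hv hp hq
  refine this.trans ?_
  unfold QQ
  rw [Real.sq_sqrt hR2.le]
  have e1 : (2*S)^2 * VJ k m a S / (4 * a) = S^2 * VJ k m a S / a := by field_simp; ring
  have e2 : (S/√k)^2 * k = S^2 := by rw [div_pow, Real.sq_sqrt hk'.le]; field_simp
  rw [e1]
  have e3 : ∀ u ≤ m^2, (2 * u + 2 * (S/√k)^2 * k) / (S * (m^2 + S^2) / a) ≤ 2 * a / S := by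
    intro u hu
    rw [mul_assoc 2, e2, div_le_div_iff₀ hR2 hS]
    have : 2 * a * (S * (m^2+S^2)/a) = 2 * S * (m^2 + S^2) := by field_simp
    rw [this]
    nlinarith
  have h1 := e3 _ hpm
  have h2 := e3 _ hqm
  have h3 : 2 * S * ((2 * (∫ x, ‖x‖^2 ∂p) + 2 * (S/√k)^2 * k) / (S * (m^2 + S^2) / a) +
     (2 * (∫ x, ‖x‖^2 ∂q) + 2 * (S/√k)^2 * k) / (S * (m^2 + S^2) / a)) ≤ 2 * S * (2 * a / S + 2 * a / S) := by
    gcongr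
  have h4 : 2 * S * (2 * a / S + 2 * a / S) = 8 * a := by field_simp; ring
  linarith

def fseq (k : ℕ) (a : ℝ) (f : EE k → ℝ) : ℕ → EE k → ℝ
  | 0 => f
  | (j+1) => TT (a * 2^j / √k) (fseq k a f j)

lemma fseq_lip (a : ℝ) {f : EE k → ℝ} (hf : LipschitzWith 1 f) {H : ℝ} (hH : ∀ x, |f x| ≤ H) (j : ℕ) :
    LipschitzWith 1 (fseq k a f j) ∧ ∀ x, |fseq k a f j x| ≤ H := by
  induction j with
  | zero => exact ⟨hf, hH⟩
  | succ j ih => exact ⟨TT_lip ih.1 ih.2 _, TT_bdd ih.2 _⟩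

lemma chain (hk : 0 < k) {m a : ℝ} (hm : 0 < m) (ha : 0 < a)
    (hp : Integrable (fun x => ‖x‖^2) p) (hq : Integrable (fun x => ‖x‖^2) q)
    (hpm : ∫ x, ‖x‖^2 ∂p ≤ m^2) (hqm : ∫ x, ‖x‖^2 ∂q ≤ m^2)
    {f : EE k → ℝ} (hf : LipschitzWith 1 f) {H : ℝ} (hH : ∀ x, |f x| ≤ H) (J : ℕ) (hJ : H ≤ 2 * (a * 2^J)) :
    |∫ x, f x ∂p - ∫ x, f x ∂q| ≤ 2 * a + ∑ j ∈ Finset.range (J+1), QQ p q m a (a * 2^j) := by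
  have hk' : (0:ℝ) < k := by exact_mod_cast hk
  have hsk : 0 < √(k:ℝ) := Real.sqrt_pos.2 hk'
  have hL := fseq_lip a hf hH
  have hI : ∀ (ν : Measure (EE k)) [IsProbabilityMeasure ν] (j : ℕ), Integrable (fseq k a f j) ν := fun ν _ j =>
    integrable_of_meas_bdd ν (hL j).1.continuous.measurable H (hL j).2
  have hcl : ∀ j i x, |fseq k a f j x - TT (a * 2^i / √k) (fseq k a f j) x| ≤ a * 2^i := by
    intro j i x
    have := TT_close (hL j).1 (hL j).2 (s := a * 2^i / √k) (by positivity) x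
    rwa [div_mul_cancel₀ _ hsk.ne'] at this
  have main : ∀ n, |(∫ x, fseq k a f 0 x ∂p - ∫ x, fseq k a f 0 x ∂q) -
      (∫ x, fseq k a f (n+1) x ∂p - ∫ x, fseq k a f (n+1) x ∂q)| ≤
      2 * a + ∑ j ∈ Finset.range n, QQ p q m a (a * 2^j) := by
    intro n
    induction n with
    | zero =>
      have hb : ∀ (ν : Measure (EE k)) [IsProbabilityMeasure ν],
          |∫ x, fseq k a f 0 x ∂ν - ∫ x, fseq k a f 1 x ∂ν| ≤ a := by
        intro ν _
        rw [← integral_sub (hI ν 0) (hI ν 1)]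
        have := norm_integral_le_of_norm_le_const (μ := ν) (f := fun x => fseq k a f 0 x - fseq k a f 1 x)
          (C := a) (ae_of_all _ fun z => by have := hcl 0 0 z; simpa [fseq] using this)
        simpa using this
      have h1 := abs_le.1 (hb p)
      have h2 := abs_le.1 (hb q)
      simp only [Finset.range_zero, Finset.sum_empty, zero_add]
      rw [abs_le]; constructor <;> linarith [h1.1, h1.2, h2.1, h2.2]
    | succ n ih =>
      rw [Finset.sum_range_succ]
      have hh : ∀ (ν : Measure (EE k)) [IsProbabilityMeasure ν],
          ∫ x, TT (a * 2^n / √k) (fun y => fseq k a f n y - TT (a * 2^(n+1) / √k) (fseq k a f n) y) x ∂ν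
          = ∫ x, fseq k a f (n+1) x ∂ν - ∫ x, fseq k a f (n+2) x ∂ν := by
        intro ν _
        rw [← integral_sub (hI ν _) (hI ν _)]
        refine integral_congr_ae (ae_of_all _ fun x => ?_)
        simp only
        rw [TT_sub (hL n).1 (hL n).2 (TT_lip (hL n).1 (hL n).2 _) (TT_bdd (hL n).2 _),
          TT_comm (hL n).1 (hL n).2]
        rfl
      have hmeas : Measurable (fun y => fseq k a f n y - TT (a * 2^(n+1) / √k) (fseq k a f n) y) :=
        (hL n).1.continuous.measurable.sub (TT_lip (hL n).1 (hL n).2 _).continuous.measurable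
      have := key2 p q hk hm ha (S := a * 2^n) (by positivity) hmeas
        (fun x => (hcl n (n+1) x).trans (le_of_eq (by ring))) hp hq hpm hqm
      rw [hh p, hh q] at this
      have h1 := abs_le.1 this
      have h2 := abs_le.1 ih
      rw [abs_le]; constructor <;> linarith [h1.1, h1.2, h2.1, h2.2]
  have h1 := abs_le.1 (main J)
  have h2 := abs_le.1 (key2 p q hk hm ha (S := a * 2^J) (by positivity) (hL J).1.continuous.measurable
        (fun x => ((hL J).2 x).trans hJ) hp hq hpm hqm)
  have e : ∀ ν : Measure (EE k), ∫ x, fseq k a f (J+1) x ∂ν = ∫ x, TT (a * 2^J / √k) (fseq k a f J) x ∂ν :=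
    fun ν => rfl
  rw [e, e] at h1
  have e0 : ∀ ν : Measure (EE k), ∫ x, fseq k a f 0 x ∂ν = ∫ x, f x ∂ν := fun ν => rfl
  rw [e0, e0] at h1
  rw [Finset.sum_range_succ, abs_le]; constructor <;> linarith [h1.1, h1.2, h2.1, h2.2]

lemma integrable_norm_of_sq' (ν : Measure (EE k)) [IsProbabilityMeasure ν] (h : Integrable (fun x => ‖x‖^2) ν) :
    Integrable (fun x => ‖x‖) ν := by
  refine (h.add (integrable_const 1)).mono' (by fun_prop) (ae_of_all _ fun z => ?_)
  simp only [norm_norm, Pi.add_apply]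
  nlinarith [sq_nonneg (‖z‖ - 1), norm_nonneg z]

/-- Chaining bound for functions bounded by one, via clipping at height `m / ε`. -/
lemma chain_clip (hk : 0 < k) {m ε : ℝ} (hm : 0 < m) (he : 0 < ε)
    (hp : Integrable (fun x => ‖x‖^2) p) (hq : Integrable (fun x => ‖x‖^2) q)
    (hpm : ∫ x, ‖x‖^2 ∂p ≤ m^2) (hqm : ∫ x, ‖x‖^2 ∂q ≤ m^2)
    {f : EE k → ℝ} (hf : LipschitzWith 1 f) (hf1 : ∀ x, |f x| ≤ 1) (J : ℕ) (hJ : 1 ≤ 2 * (2^J * ε^2)) :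
    |∫ x, f x ∂p - ∫ x, f x ∂q| ≤
      4 * (m * ε) + ∑ j ∈ Finset.range (J+1), QQ p q m (m * ε) (m * ε * 2^j) := by
  set H := m / ε with hH
  have hH0 : 0 < H := by positivity
  set g : EE k → ℝ := fun x => max (-H) (min H (f x - f 0)) with hg
  have hgl : LipschitzWith 1 g := by
    have h1 : LipschitzWith 1 (fun x => f x - f 0) := by
      refine LipschitzWith.of_dist_le_mul fun x y => ?_
      have := hf.dist_le_mul x y
      simpa [Real.dist_eq] using this
    exact (h1.const_min H).const_max (-H)
  have hgb : ∀ x, |g x| ≤ H := by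
    intro x
    rw [abs_le]
    exact ⟨le_max_left _ _, max_le (by linarith) (min_le_left _ _)⟩
  have hd : ∀ x, |(f x - f 0) - g x| ≤ ‖x‖^2 / H := by
    intro x
    have h1 := lip_abs hf x 0
    rw [sub_zero] at h1
    simp only [hg]
    generalize f x - f 0 = u at *
    have h2 : u^2 ≤ ‖x‖^2 := by rw [← sq_abs u]; gcongr
    refine le_trans ?_ (div_le_div_of_nonneg_right h2 hH0.le)
    rw [le_div_iff₀ hH0]
    rcases le_total H u with h | h
    · rw [min_eq_left h, max_eq_right (by linarith), abs_of_nonneg (by linarith)]; nlinarith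
    · rw [min_eq_right h]
      rcases le_total (-H) u with h' | h'
      · rw [max_eq_right h']; simp; positivity
      · rw [max_eq_left h', abs_of_nonpos (by linarith)]; nlinarith
  have hc := chain p q hk hm (a := m * ε) (by positivity) hp hq hpm hqm hgl hgb J (by
    rw [hH, div_le_iff₀ he]; nlinarith)
  have hb : ∀ (ν : Measure (EE k)) [IsProbabilityMeasure ν], Integrable (fun x => ‖x‖^2) ν →
      ∫ x, ‖x‖^2 ∂ν ≤ m^2 → |∫ x, f x ∂ν - f 0 - ∫ x, g x ∂ν| ≤ m * ε := by
    intro ν _ hν hνm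
    have i1 : Integrable f ν := integrable_of_meas_bdd ν hf.continuous.measurable 1 hf1
    have i2 : Integrable g ν := integrable_of_meas_bdd ν hgl.continuous.measurable H hgb
    have e : ∫ x, f x ∂ν - f 0 - ∫ x, g x ∂ν = ∫ x, ((f x - f 0) - g x) ∂ν := by
      have i3 : Integrable (fun x => f x - f 0) ν := i1.sub (integrable_const _)
      rw [integral_sub i3 i2, integral_sub i1 (integrable_const _)]; simp
    rw [e]
    refine (abs_integral_le_integral_abs).trans ?_
    refine (integral_mono_of_nonneg (ae_of_all _ fun z => abs_nonneg _) (hν.div_const H) (ae_of_all _ hd)).trans ?_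
    rw [integral_div, div_le_iff₀ hH0, hH]
    have : m * ε * (m / ε) = m^2 := by field_simp
    rwa [this]
  have h1 := abs_le.1 (hb p hp hpm)
  have h2 := abs_le.1 (hb q hq hqm)
  have h3 := abs_le.1 hc
  rw [abs_le]; constructor <;> linarith [h1.1, h1.2, h2.1, h2.2, h3.1, h3.2]

end

lemma continuous_stiefelProj {d k : ℕ} (θ : Stiefel d k) : Continuous (stiefelProj θ) := by
  unfold stiefelProj
  exact (EuclideanSpace.equiv (Fin k) ℝ).symm.continuous.comp (by fun_prop)

def pth {d k : ℕ} (Λ : Measure (EE d)) (θ : Stiefel d k) : Measure (EE k) := Λ.map (stiefelProj θ)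
def qbar {d : ℕ} (k : ℕ) (Λ : Measure (EE d)) : Measure (EE k) :=
  (Λ.prod (gam k)).map (fun w => (‖w.1‖/√d) • w.2)

section
variable {d k : ℕ} (Λ : Measure (EE d)) [IsProbabilityMeasure Λ]

instance pth_prob (θ : Stiefel d k) : IsProbabilityMeasure (pth Λ θ) :=
  Measure.isProbabilityMeasure_map (continuous_stiefelProj θ).measurable.aemeasurable

instance qbar_prob : IsProbabilityMeasure (qbar k Λ) :=
  Measure.isProbabilityMeasure_map (Measurable.aemeasurable (by fun_prop))

lemma Fc_pth (θ : Stiefel d k) (t : EE k) : Fc (pth Λ θ) t = Fc Λ (vth t θ) := by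
  unfold Fc pth
  rw [integral_map (continuous_stiefelProj θ).measurable.aemeasurable (Measurable.aestronglyMeasurable (by fun_prop))]
  simp_rw [inner_vth]

lemma Fs_pth (θ : Stiefel d k) (t : EE k) : Fs (pth Λ θ) t = Fs Λ (vth t θ) := by
  unfold Fs pth
  rw [integral_map (continuous_stiefelProj θ).measurable.aemeasurable (Measurable.aestronglyMeasurable (by fun_prop))]
  simp_rw [inner_vth]

lemma Fc_qbar (t : EE k) : Fc (qbar k Λ) t = mm Λ (‖t‖/√d) := by
  unfold Fc qbar mm
  rw [integral_map (Measurable.aemeasurable (by fun_prop)) (Measurable.aestronglyMeasurable (by fun_prop)),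
    integral_prod _ (integrable_of_meas_bdd _ (by fun_prop) 1 (fun u => abs_cos_le_one _))]
  refine integral_congr_ae (ae_of_all _ fun x => ?_)
  simp only
  have : ∀ z : EE k, ⟪(‖x‖/√d) • z, t⟫ = ⟪z, (‖x‖/√d) • t⟫ := fun z => by
    rw [real_inner_smul_left, real_inner_smul_right]
  simp_rw [this]
  rw [gam_cos, norm_smul, Real.norm_eq_abs, mul_pow, sq_abs]
  congr 1; ring

lemma Fs_qbar (t : EE k) : Fs (qbar k Λ) t = 0 := by
  unfold Fs qbar
  rw [integral_map (Measurable.aemeasurable (by fun_prop)) (Measurable.aestronglyMeasurable (by fun_prop)),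
    integral_prod _ (integrable_of_meas_bdd _ (by fun_prop) 1 (fun u => abs_sin_le_one _))]
  have : ∀ (x : EE d) (z : EE k), ⟪(‖x‖/√d) • z, t⟫ = ⟪z, (‖x‖/√d) • t⟫ := fun x z => by
    rw [real_inner_smul_left, real_inner_smul_right]
  simp_rw [this, gam_sin]
  simp

lemma measurable_mm : Measurable (mm Λ) := by
  have : StronglyMeasurable (fun p : ℝ × EE d => Real.exp (-(p.1^2 * ‖p.2‖^2)/2)) :=
    Measurable.stronglyMeasurable (by fun_prop)
  exact (this.integral_prod_right (ν := Λ)).measurable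

lemma NN_eq (θ : Stiefel d k) (s : ℝ) : NN (pth Λ θ) (qbar k Λ) s =
    KK k s * ∫ g, Phi Λ (mm Λ (‖(1/(√2 * s)) • g‖/√d)) (vth ((1/(√2 * s)) • g) θ) ∂(gam k) := by
  unfold NN Phi
  simp_rw [Fc_pth, Fs_pth, Fc_qbar, Fs_qbar, sub_zero]

lemma ENN {B : ℝ} (hX : Integrable (fun x => ‖x‖^2) Λ) (hB0 : 0 < B)
    (hB : ∀ v : EE d, ∫ x, ⟪x, v⟫^2 ∂Λ ≤ B * ‖v‖^2) (hd : 0 < d)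
    (μ : Measure (Stiefel d k)) (hμ : IsHaarStiefel μ) (s : ℝ) :
    Integrable (fun θ => NN (pth Λ θ) (qbar k Λ) s) μ ∧
    ∫ θ, NN (pth Λ θ) (qbar k Λ) s ∂μ ≤ KK k s * ((4+4*VV) * (B * (k / (2 * s^2)) / d)) := by
  have := hμ.1
  have hKK : 0 ≤ KK k s := by unfold KK; positivity
  set c := 1/(√2 * s) with hc
  have m1 := measurable_Fc Λ
  have m2 := measurable_Fs Λ
  have m3 := measurable_mm Λ
  have m4 : Measurable (fun p : Stiefel d k × EE k => vth (c • p.2) p.1) :=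
    measurable_vth.comp (measurable_fst.prodMk (measurable_snd.const_smul c))
  have hInt : Integrable (fun p : Stiefel d k × EE k => Phi Λ (mm Λ (‖c • p.2‖/√d)) (vth (c • p.2) p.1)) (μ.prod (gam k)) := by
    refine integrable_of_meas_bdd _ ?_ 5 (fun p => ?_)
    · unfold Phi; fun_prop
    · have := Phi_bdd Λ _ (abs_mm_le Λ (‖c • p.2‖/√d)) (vth (c • p.2) p.1)
      rw [abs_of_nonneg this.1]; exact this.2
  simp_rw [NN_eq]
  refine ⟨hInt.integral_prod_left.const_mul _, ?_⟩
  rw [integral_const_mul, integral_integral_swap hInt]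
  refine mul_le_mul_of_nonneg_left ?_ hKK
  have hi : Integrable (fun g : EE k => (4+4*VV) * (B * ‖c • g‖^2 / d)) (gam k) := by
    simp_rw [norm_smul, mul_pow]
    exact ((((gam_integrable_normsq k).const_mul _).const_mul B).div_const _).const_mul _
  refine (integral_mono_of_nonneg (ae_of_all _ fun g => integral_nonneg fun θ =>
    (Phi_bdd Λ _ (abs_mm_le Λ (‖c • g‖/√d)) (vth (c • g) θ)).1) hi (ae_of_all _ fun g => 
      haar_var Λ hX hB0 hB hd μ hμ (c • g))).trans (le_of_eq ?_)
  simp_rw [norm_smul, mul_pow]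
  rw [integral_const_mul, integral_div, integral_const_mul, integral_const_mul, gam_normsq, Real.norm_eq_abs,
    sq_abs, hc, div_pow, mul_pow, Real.sq_sqrt (by norm_num)]
  ring

lemma pth_sq {B : ℝ} (hX : Integrable (fun x => ‖x‖^2) Λ) 
    (hB : ∀ v : EE d, ∫ x, ⟪x, v⟫^2 ∂Λ ≤ B * ‖v‖^2) (θ : Stiefel d k) :
    Integrable (fun x => ‖x‖^2) (pth Λ θ) ∧ ∫ x, ‖x‖^2 ∂(pth Λ θ) ≤ k * B := by
  have hi : ∀ j : Fin k, Integrable (fun x => ⟪x, θ.1 j⟫^2) Λ := fun j => by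
    refine (hX.const_mul (‖θ.1 j‖^2)).mono' (Measurable.aestronglyMeasurable (by fun_prop)) (ae_of_all _ fun x => ?_)
    have := abs_real_inner_le_norm x (θ.1 j)
    rw [Real.norm_eq_abs, abs_of_nonneg (sq_nonneg _), ← sq_abs, ← mul_pow, mul_comm]
    gcongr
  have hm := (continuous_stiefelProj θ).measurable.aemeasurable (μ := Λ)
  unfold pth
  rw [integrable_map_measure (Measurable.aestronglyMeasurable (by fun_prop)) hm,
    integral_map hm (Measurable.aestronglyMeasurable (by fun_prop))]
  have e : ((fun x : EE k => ‖x‖^2) ∘ stiefelProj θ) = fun x => ∑ j, ⟪x, θ.1 j⟫^2 := by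
    funext x; exact norm_stiefelProj_le θ x
  rw [e]
  refine ⟨integrable_finsetSum _ fun j _ => hi j, ?_⟩
  simp_rw [norm_stiefelProj_le]
  rw [integral_finsetSum _ fun j _ => hi j]
  refine (Finset.sum_le_sum (fun j _ => hB (θ.1 j))).trans (le_of_eq ?_)
  simp [θ.2.1]

lemma qbar_sq (hd : 0 < d) (hX : Integrable (fun x => ‖x‖^2) Λ) {σ : ℝ} (hσ : ∫ x, ‖x‖^2 ∂Λ = σ^2 * d) :
    Integrable (fun x => ‖x‖^2) (qbar k Λ) ∧ ∫ x, ‖x‖^2 ∂(qbar k Λ) = k * σ^2 := by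
  have hd' : (0:ℝ) < d := by exact_mod_cast hd
  have hm : AEMeasurable (fun w : EE d × EE k => (‖w.1‖/√d) • w.2) (Λ.prod (gam k)) :=
    Measurable.aemeasurable (by fun_prop)
  have e : ∀ w : EE d × EE k, ‖(‖w.1‖/√d) • w.2‖^2 = (‖w.1‖^2/d) * ‖w.2‖^2 := fun w => by
    rw [norm_smul, mul_pow, Real.norm_eq_abs, sq_abs, div_pow, Real.sq_sqrt hd'.le]
  unfold qbar
  rw [integrable_map_measure (Measurable.aestronglyMeasurable (by fun_prop)) hm,
    integral_map hm (Measurable.aestronglyMeasurable (by fun_prop))]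
  simp_rw [Function.comp_def, e]
  refine ⟨(hX.div_const _).mul_prod (gam_integrable_normsq k), ?_⟩
  rw [integral_prod_mul (fun x : EE d => ‖x‖^2/d) (fun z : EE k => ‖z‖^2), gam_normsq, integral_div, hσ]
  field_simp

end

lemma k_bound (k : ℕ) : (k:ℝ) * (5/9)^k ≤ 5/4 := by
  have h := one_add_mul_le_pow (a := (4/5:ℝ)) (by norm_num) k
  have e : ((5:ℝ)/9)^k * (1 + 4/5)^k = 1 := by rw [← mul_pow]; norm_num
  have : (0:ℝ) < (5/9)^k := by positivity
  have h2 := mul_le_mul_of_nonneg_left h this.le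
  rw [e] at h2
  nlinarith

lemma VJKK (k : ℕ) (hk : 0 < k) {m ε S : ℝ} (hm : 0 < m) (he : 0 < ε) (hS1 : m * ε ≤ S) (hS2 : S ≤ m / ε) :
    VJ k m (m * ε) S * KK k (S / √k) ≤ (5/(3*ε))^k := by
  have hk' : (0:ℝ) < k := by exact_mod_cast hk
  have hS : 0 < S := lt_of_lt_of_le (by positivity) hS1
  set r := S * (m^2 + S^2) / (m * ε) with hr
  have hr0 : 0 < r := by positivity
  have hs2 : (S/√k)^2 = S^2/k := by rw [div_pow, Real.sq_sqrt hk'.le]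
  have e1 : (2 * π * (S/√k)^2) ^ (-(k:ℝ)) = (((2 * π * (S^2/k))^2)⁻¹) ^ ((k:ℝ)/2) := by
    rw [hs2, ← Real.rpow_natCast (2 * π * (S^2/k)) 2, ← Real.rpow_neg (by positivity), ← Real.rpow_mul (by positivity)]
    congr 1; push_cast; ring
  have e2 : Real.exp ((k:ℝ)/2) = (Real.exp 1) ^ ((k:ℝ)/2) := by rw [← Real.exp_mul, one_mul]
  have e3 : VJ k m (m * ε) S * KK k (S / √k) = (Real.exp 1 * (r / (2 * S^2))) ^ ((k:ℝ)/2) := by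
    unfold VJ KK
    rw [e1, e2, hs2, ← hr, ← Real.mul_rpow (by positivity) (by positivity), ← Real.mul_rpow (by positivity) (by positivity),
      ← Real.mul_rpow (by positivity) (by positivity)]
    congr 1; field_simp
  have hrS : r / (2 * S^2) ≤ 1/ε^2 := by
    rw [hr, div_div, div_le_div_iff₀ (by positivity) (by positivity)]
    rw [le_div_iff₀ he] at hS2
    have h1 : m * (m * ε) * ε ≤ m * S * ε := by gcongr
    have h2 : (S * ε) * (S * ε) ≤ (S * ε) * m := by gcongr
    have h3 : m^2 * ε^2 + S^2 * ε^2 ≤ 2 * (m * S * ε) := by nlinarith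
    have h4 := mul_le_mul_of_nonneg_left h3 hS.le
    nlinarith
  have hexp : Real.exp 1 ≤ 25/9 := by have := Real.exp_one_lt_d9; linarith
  rw [e3]
  have e4 : (5/(3*ε))^k = ((5/(3*ε))^2) ^ ((k:ℝ)/2) := by
    rw [← Real.rpow_natCast (5/(3*ε)) 2, ← Real.rpow_mul (by positivity), ← Real.rpow_natCast]
    congr 1; push_cast; ring
  rw [e4]
  refine Real.rpow_le_rpow (by positivity) ?_ (by positivity)
  calc Real.exp 1 * (r / (2 * S^2)) ≤ 25/9 * (1/ε^2) := by gcongr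
    _ = (5/(3*ε))^2 := by rw [div_pow]; ring

lemma num_bound {d k : ℕ} (hd : 0 < d) (hk : 0 < k) {m ε S B : ℝ} (hm : 0 < m) (he : 0 < ε) (hB : 0 < B)
    (hmB : m^2 = k * B) (hεd : d * ε^(k+2) = 3^(k+2)) (hS1 : m * ε ≤ S) (hS2 : S ≤ m / ε) :
    S^2 * VJ k m (m * ε) S / (m * ε) * (KK k (S/√k) * ((4+4*VV) * (B * (k / (2 * (S/√k)^2)) / d)))
      ≤ (1 + VV) * (m * ε) := by
  have hk' : (0:ℝ) < k := by exact_mod_cast hk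
  have hd' : (0:ℝ) < d := by exact_mod_cast hd
  have hV := VV_nonneg
  have hS : 0 < S := lt_of_lt_of_le (by positivity) hS1
  have h1 := VJKK k hk hm he hS1 hS2
  have hs2 : (S/√k)^2 = S^2/k := by rw [div_pow, Real.sq_sqrt hk'.le]
  have e : S^2 * VJ k m (m * ε) S / (m * ε) * (KK k (S/√k) * ((4+4*VV) * (B * (k / (2 * (S/√k)^2)) / d)))
    = (VJ k m (m * ε) S * KK k (S / √k)) * ((2 + 2 * VV) * B * k^2 / (d * (m * ε))) := by
    rw [hs2]; field_simp; ring
  rw [e]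
  refine (mul_le_mul_of_nonneg_right h1 (by positivity)).trans ?_
  have hd2 : (d:ℝ) = 3^(k+2) / ε^(k+2) := by rw [eq_div_iff (by positivity)]; exact hεd
  have e2 : (5/(3*ε))^k * ((2 + 2 * VV) * B * k^2 / (d * (m * ε))) =
     (2 + 2*VV) * (k * B) * ((k:ℝ) * (5/9)^k) * ε^2 / (9 * (m * ε)) := by
    rw [hd2]
    have : (5/(3*ε))^k = (5/9)^k * 3^k / ε^k := by
      rw [← mul_pow, ← div_pow]; congr 1; field_simp; norm_num
    rw [this, pow_add, pow_add]
    field_simp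
    norm_num
  rw [e2, ← hmB]
  have h2 := k_bound k
  have h3 : (2 + 2*VV) * m^2 * ((k:ℝ) * (5/9)^k) * ε^2 / (9 * (m * ε)) ≤ (2 + 2*VV) * m^2 * (5/4) * ε^2 / (9 * (m * ε)) := by
    gcongr
  refine h3.trans ?_
  have e5 : (2 + 2*VV) * m^2 * (5/4) * ε^2 / (9 * (m * ε)) = (5/18) * ((1+VV) * (m * ε)) := by field_simp; ring
  rw [e5]
  have : 0 ≤ (1+VV) * (m * ε) := by positivity
  linarith

lemma B_ge {d : ℕ} (hd : 0 < d) (Λ : Measure (EE d)) [IsProbabilityMeasure Λ] {B σ : ℝ}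
    (hX : Integrable (fun x => ‖x‖^2) Λ) (hσ : ∫ x, ‖x‖^2 ∂Λ = σ^2 * d)
    (hB : ∀ v : EE d, ∫ x, ⟪x, v⟫^2 ∂Λ ≤ B * ‖v‖^2) : σ^2 ≤ B := by
  have hd' : (0:ℝ) < d := by exact_mod_cast hd
  let b := EuclideanSpace.basisFun (Fin d) ℝ
  have hi : ∀ j : Fin d, Integrable (fun x => ⟪x, b j⟫^2) Λ := fun j => by
    refine (hX.const_mul (‖b j‖^2)).mono' (Measurable.aestronglyMeasurable (by fun_prop)) (ae_of_all _ fun x => ?_)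
    have := abs_real_inner_le_norm x (b j)
    rw [Real.norm_eq_abs, abs_of_nonneg (sq_nonneg _), ← sq_abs, ← mul_pow, mul_comm]
    gcongr
  have h1 : ∀ x : EE d, ‖x‖^2 = ∑ j, ⟪x, b j⟫^2 := fun x => (b.sum_sq_inner_left x).symm
  simp_rw [h1] at hσ
  rw [integral_finsetSum _ fun j _ => hi j] at hσ
  have h2 := Finset.sum_le_sum (s := Finset.univ) (fun j _ => hB (b j))
  rw [hσ] at h2
  simp only [b.norm_eq_one, one_pow, mul_one, Finset.sum_const, Finset.card_univ, Fintype.card_fin, nsmul_eq_mul] at h2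
  nlinarith

lemma dBL_le {k : ℕ} {p ν : Measure (EE k)} {W : ℝ}
    (h : ∀ f : EE k → ℝ, (∀ x, |f x| ≤ 1) → LipschitzWith 1 f → |∫ x, f x ∂p - ∫ x, f x ∂ν| ≤ W) :
    dBL p ν ≤ W := by
  have : Nonempty {f : EE k → ℝ // (∀ x, |f x| ≤ 1) ∧ LipschitzWith 1 f} :=
    ⟨⟨fun _ => 0, by simp, LipschitzWith.const' 0⟩⟩
  exact ciSup_le fun f => h f.1 f.2.1 f.2.2

lemma dBL_nonneg {k : ℕ} (p ν : Measure (EE k)) : 0 ≤ dBL p ν := Real.iSup_nonneg fun _ => abs_nonneg _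

lemma sigZ_prob (k : ℕ) (σ : ℝ) : IsProbabilityMeasure ((gam k).map fun z => σ • z) :=
  Measure.isProbabilityMeasure_map (Measurable.aemeasurable (by fun_prop))

lemma qbar_close {d : ℕ} (k : ℕ) (hd : 0 < d) (Λ : Measure (EE d)) [IsProbabilityMeasure Λ] {σ : ℝ} (hσ0 : 0 < σ)
    (hX : Integrable (fun x => ‖x‖^2) Λ) {f : EE k → ℝ} (hf1 : ∀ x, |f x| ≤ 1) (hf : LipschitzWith 1 f) :
    |∫ x, f x ∂(qbar k Λ) - ∫ x, f x ∂((gam k).map fun z => σ • z)| ≤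
      √k * σ * (∫ x, |‖x‖^2 * (σ^2)⁻¹ - (d:ℝ)| ∂Λ) / d := by
  have hd' : (0:ℝ) < d := by exact_mod_cast hd
  have hfc := hf.continuous
  have i1 : Integrable (fun w : EE d × EE k => f ((‖w.1‖/√d) • w.2)) (Λ.prod (gam k)) :=
    integrable_of_meas_bdd _ (hfc.measurable.comp (by fun_prop)) 1 (fun w => hf1 _)
  have i2 : Integrable (fun w : EE d × EE k => f (σ • w.2)) (Λ.prod (gam k)) :=
    integrable_of_meas_bdd _ (hfc.measurable.comp (by fun_prop)) 1 (fun w => hf1 _)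
  have e2 : ∫ x, f x ∂((gam k).map fun z => σ • z) = ∫ w, f (σ • w.2) ∂(Λ.prod (gam k)) := by
    rw [integral_map (Measurable.aemeasurable (by fun_prop)) hfc.aestronglyMeasurable, integral_prod _ i2]
    simp
  have e1 : ∫ x, f x ∂(qbar k Λ) = ∫ w, f ((‖w.1‖/√d) • w.2) ∂(Λ.prod (gam k)) := by
    rw [qbar, integral_map (Measurable.aemeasurable (by fun_prop)) hfc.aestronglyMeasurable]
  rw [e1, e2, ← integral_sub i1 i2]
  refine (abs_integral_le_integral_abs).trans ?_
  have hA : Integrable (fun x : EE d => |‖x‖^2 * (σ^2)⁻¹ - (d:ℝ)|) Λ :=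
    ((hX.mul_const _).sub (integrable_const _)).abs
  have hpt : ∀ w : EE d × EE k, |f ((‖w.1‖/√d) • w.2) - f (σ • w.2)| ≤
      (σ / d * |‖w.1‖^2 * (σ^2)⁻¹ - (d:ℝ)|) * ‖w.2‖ := by
    intro w
    refine (lip_abs hf _ _).trans ?_
    rw [← sub_smul, norm_smul, Real.norm_eq_abs]
    refine mul_le_mul_of_nonneg_right ?_ (norm_nonneg _)
    have hsd : 0 < √(d:ℝ) := Real.sqrt_pos.2 hd'
    obtain ⟨u, hu⟩ : ∃ u, u = ‖w.1‖/√d/σ := ⟨_, rfl⟩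
    have hu0 : 0 ≤ u := by rw [hu]; positivity
    have e3 : ‖w.1‖/√d - σ = σ * (u - 1) := by rw [hu]; field_simp
    have e4 : ‖w.1‖^2 * (σ^2)⁻¹ - (d:ℝ) = d * (u^2 - 1) := by
      rw [hu, div_pow, div_pow, Real.sq_sqrt hd'.le]; field_simp
    rw [e3, e4, abs_mul, abs_mul, abs_of_pos hσ0, abs_of_pos hd', show u^2-1 = (u-1)*(u+1) by ring, abs_mul]
    have : σ / d * (d * (|u-1| * |u+1|)) = σ * (|u-1| * |u+1|) := by field_simp
    rw [this]
    gcongr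
    rw [abs_of_nonneg (by linarith : 0 ≤ u+1)]
    nlinarith [abs_nonneg (u-1)]
  have hi : Integrable (fun w : EE d × EE k => (σ / d * |‖w.1‖^2 * (σ^2)⁻¹ - (d:ℝ)|) * ‖w.2‖) (Λ.prod (gam k)) :=
    (hA.const_mul _).mul_prod (gam_integrable_norm k)
  refine (integral_mono_of_nonneg (ae_of_all _ fun w => abs_nonneg _) hi (ae_of_all _ hpt)).trans ?_
  rw [integral_prod_mul (fun x : EE d => σ / d * |‖x‖^2 * (σ^2)⁻¹ - (d:ℝ)|) (fun z : EE k => ‖z‖), integral_const_mul]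
  have hAn : 0 ≤ ∫ x, |‖x‖^2 * (σ^2)⁻¹ - (d:ℝ)| ∂Λ := integral_nonneg fun _ => abs_nonneg _
  calc σ / d * (∫ x, |‖x‖^2 * (σ^2)⁻¹ - (d:ℝ)| ∂Λ) * ∫ z, ‖z‖ ∂(gam k)
      ≤ σ / d * (∫ x, |‖x‖^2 * (σ^2)⁻¹ - (d:ℝ)| ∂Λ) * √k := by
        gcongr; exact gam_norm_le k
    _ = _ := by ring

lemma int_le_of_pt {α : Type*} [MeasurableSpace α] (μ : Measure α) {F G : α → ℝ} (hG : Integrable G μ)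
    (hF : ∀ a, 0 ≤ F a) (h : ∀ a, F a ≤ G a) : ∫ a, F a ∂μ ≤ ∫ a, G a ∂μ :=
  integral_mono_of_nonneg (ae_of_all _ hF) hG (ae_of_all _ h)

lemma triv_bound {k : ℕ} (p ν : Measure (EE k)) [IsProbabilityMeasure p] [IsProbabilityMeasure ν] : dBL p ν ≤ 2 := by
  refine dBL_le fun f hf1 _ => ?_
  have h1 := abs_le.1 (abs_integral_le_one p hf1)
  have h2 := abs_le.1 (abs_integral_le_one ν hf1)
  rw [abs_le]; constructor <;> linarith [h1.1, h1.2, h2.1, h2.2]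

lemma triv_bound2 {k : ℕ} (p ν : Measure (EE k)) [IsProbabilityMeasure p] [IsProbabilityMeasure ν]
    {m : ℝ} (hm : 0 < m) (hp : Integrable (fun x => ‖x‖^2) p) (hq : Integrable (fun x => ‖x‖^2) ν)
    (hpm : ∫ x, ‖x‖^2 ∂p ≤ m^2) (hqm : ∫ x, ‖x‖^2 ∂ν ≤ m^2) : dBL p ν ≤ 2 * m := by
  refine dBL_le fun f hf1 hf => ?_
  have hb : ∀ (ν : Measure (EE k)) [IsProbabilityMeasure ν], Integrable (fun x => ‖x‖^2) ν →
      ∫ x, ‖x‖^2 ∂ν ≤ m^2 → |∫ x, f x ∂ν - f 0| ≤ m := by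
    intro ν _ hν hνm
    have i1 : Integrable f ν := integrable_of_meas_bdd ν hf.continuous.measurable 1 hf1
    have e : ∫ x, f x ∂ν - f 0 = ∫ x, (f x - f 0) ∂ν := by
      rw [integral_sub i1 (integrable_const _)]; simp
    rw [e]
    refine (abs_integral_le_integral_abs).trans ?_
    refine (integral_mono_of_nonneg (ae_of_all _ fun z => abs_nonneg _) (integrable_norm_of_sq' ν hν)
      (ae_of_all _ fun x => by have := lip_abs hf x 0; rwa [sub_zero] at this)).trans ?_
    have := sq_integral_le ν (f := fun g : EE k => ‖g‖) (by fun_prop) hν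
    exact abs_le_of_sq_le_sq' (this.trans hνm) hm.le |>.2
  have h1 := abs_le.1 (hb p hp hpm)
  have h2 := abs_le.1 (hb ν hq hqm)
  rw [abs_le]; constructor <;> linarith [h1.1, h1.2, h2.1, h2.2]

lemma sigZ_sq (k : ℕ) (σ : ℝ) : Integrable (fun x => ‖x‖^2) ((gam k).map fun z => σ • z) ∧
    ∫ x, ‖x‖^2 ∂((gam k).map fun z => σ • z) = k * σ^2 := by
  have hm : AEMeasurable (fun z : EE k => σ • z) (gam k) := Measurable.aemeasurable (by fun_prop)
  have e : ∀ z : EE k, ‖σ • z‖^2 = σ^2 * ‖z‖^2 := fun z => by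
    rw [norm_smul, mul_pow, Real.norm_eq_abs, sq_abs]
  rw [integrable_map_measure (Measurable.aestronglyMeasurable (by fun_prop)) hm,
    integral_map hm (Measurable.aestronglyMeasurable (by fun_prop))]
  simp_rw [Function.comp_def, e]
  refine ⟨(gam_integrable_normsq k).const_mul _, ?_⟩
  rw [integral_const_mul, gam_normsq, mul_comm]

lemma core {d k : ℕ} (hd : 0 < d) (hk : 0 < k) (Λ : Measure (EE d)) [IsProbabilityMeasure Λ] {B σ m ε : ℝ}
    (hσ0 : 0 < σ) (hX : Integrable (fun x => ‖x‖^2) Λ) (hσ : ∫ x, ‖x‖^2 ∂Λ = σ^2 * d)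
    (hB : ∀ v : EE d, ∫ x, ⟪x, v⟫^2 ∂Λ ≤ B * ‖v‖^2)
    (μ : Measure (Stiefel d k)) (hμ : IsHaarStiefel μ)
    (hm : 0 < m) (he : 0 < ε) (hmB : m^2 = k * B) (hεd : d * ε^(k+2) = 3^(k+2))
    (J : ℕ) (hJ1 : 1 ≤ 2 * (2^J * ε^2)) (hJ2 : 2^J * ε^2 ≤ 1) :
    ∫ θ, dBL (pth Λ θ) ((gam k).map fun z => σ • z) ∂μ ≤ m * ε * (4 + (J+1) * (10 + VV)) +
      √k * σ * (∫ x, |‖x‖^2 * (σ^2)⁻¹ - (d:ℝ)| ∂Λ) / d := by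
  have := hμ.1
  have hk' : (0:ℝ) < k := by exact_mod_cast hk
  have hBσ := B_ge hd Λ hX hσ hB
  have hB0 : 0 < B := lt_of_lt_of_le (by positivity) hBσ
  set W := √k * σ * (∫ x, |‖x‖^2 * (σ^2)⁻¹ - (d:ℝ)| ∂Λ) / d
  have ha : 0 < m * ε := by positivity
  have hqs := qbar_sq (k := k) Λ hd hX hσ
  have hpt : ∀ θ, dBL (pth Λ θ) ((gam k).map fun z => σ • z) ≤
      (4 * (m * ε) + ∑ j ∈ Finset.range (J+1), QQ (pth Λ θ) (qbar k Λ) m (m * ε) (m * ε * 2^j)) + W := by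
    intro θ
    refine dBL_le fun f hf1 hf => ?_
    have hps := pth_sq Λ hX hB θ
    have h1 := chain_clip (pth Λ θ) (qbar k Λ) hk hm he hps.1 hqs.1 (hps.2.trans hmB.ge)
      (by rw [hqs.2, hmB]; gcongr) hf hf1 J hJ1
    have h2 := qbar_close k hd Λ hσ0 hX hf1 hf
    have h1' := abs_le.1 h1
    have h2' := abs_le.1 h2
    rw [abs_le]; constructor <;> linarith [h1'.1, h1'.2, h2'.1, h2'.2]
  have hN := fun s => ENN Λ hX hB0 hB hd μ hμ s
  have hQi : ∀ S, Integrable (fun θ => QQ (pth Λ θ) (qbar k Λ) m (m * ε) S) μ := fun S =>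
    (integrable_const _).add ((hN _).1.const_mul _)
  have hQ : ∀ j ∈ Finset.range (J+1), ∫ θ, QQ (pth Λ θ) (qbar k Λ) m (m * ε) (m * ε * 2^j) ∂μ ≤ m * ε * (10 + VV) := by
    intro j hj
    set S := m * ε * 2^j with hS
    have hj' : j ≤ J := by rw [Finset.mem_range] at hj; omega
    have hS1 : m * ε ≤ S := le_mul_of_one_le_right ha.le (one_le_pow₀ (by norm_num))
    have hS0 : 0 < S := by positivity
    have hS2 : S ≤ m / ε := by
      rw [le_div_iff₀ he, hS]
      have : (2:ℝ)^j ≤ 2^J := pow_le_pow_right₀ (by norm_num) hj'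
      have h3 : (2:ℝ)^j * ε^2 ≤ 1 := (mul_le_mul_of_nonneg_right this (by positivity)).trans hJ2
      nlinarith
    have hnb := num_bound hd hk hm he hB0 hmB hεd hS1 hS2
    unfold QQ
    rw [integral_add (integrable_const _) ((hN _).1.const_mul _), integral_const_mul (S^2 * VJ k m (m * ε) S / (m * ε))]
    have hV : 0 ≤ VJ k m (m * ε) S := by unfold VJ; positivity
    have h4 := mul_le_mul_of_nonneg_left (hN (S/√k)).2 (by positivity : 0 ≤ S^2 * VJ k m (m * ε) S / (m * ε))
    simp only [integral_const, probReal_univ, one_smul]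
    linarith
  have hsum : Integrable (fun θ => ∑ j ∈ Finset.range (J+1), QQ (pth Λ θ) (qbar k Λ) m (m * ε) (m * ε * 2^j)) μ :=
    integrable_finsetSum _ fun j _ => hQi _
  have h5 : Integrable (fun θ => 4 * (m * ε) + ∑ j ∈ Finset.range (J+1), QQ (pth Λ θ) (qbar k Λ) m (m * ε) (m * ε * 2^j)) μ :=
    (integrable_const _).add hsum
  refine (int_le_of_pt μ (h5.add (integrable_const W)) (fun θ => dBL_nonneg _ _) hpt).trans ?_
  rw [integral_add' h5 (integrable_const W), integral_add (integrable_const _) hsum,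
    integral_finsetSum _ fun j _ => hQi _]
  have h6 := Finset.sum_le_sum hQ
  simp only [Finset.sum_const, Finset.card_range, nsmul_eq_mul] at h6
  push_cast at h6
  simp only [integral_const, probReal_univ, one_smul]
  linarith

lemma final_num {d k : ℕ} (hd : 0 < d) (hk : 0 < k) {B : ℝ} (hB : 0 < B) :
    (√(k * B) * (d:ℝ) ^ (-(1:ℝ)/(k+2)) * (1 + Real.log d / k)) ^ (((2:ℝ)*k+4)/(3*k+4)) ≤
      Real.exp 1 * (((k * B + B * Real.log d) * B ^ ((2 : ℝ) / (9 * k + 12)))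
                / ((k * B) ^ ((2 : ℝ) / 3) * (d : ℝ) ^ ((2 : ℝ) / (3 * k + 4)))) := by
  have hk' : (0:ℝ) < k := by exact_mod_cast hk
  have hd' : (0:ℝ) < d := by exact_mod_cast hd
  have hlog : 0 ≤ Real.log d := Real.log_natCast_nonneg d
  set L := 1 + Real.log d / k with hL
  have hL1 : 1 ≤ L := by rw [hL]; have : 0 ≤ Real.log d / k := by positivity
                         linarith
  set α := ((2:ℝ)*k+4)/(3*k+4) with hα
  set δ := (2:ℝ)/(9*k+12) with hδ
  have hα1 : α ≤ 1 := by rw [hα, div_le_one (by positivity)]; linarith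
  have hα0 : 0 < α := by positivity
  have e1 : (√(k * B)) ^ α = (k*B)^((1:ℝ)/3) * (k ^ δ * B ^ δ) := by
    rw [Real.sqrt_eq_rpow, ← Real.rpow_mul (by positivity), ← Real.mul_rpow hk'.le hB.le,
      ← Real.rpow_add (by positivity)]
    congr 1
    rw [hα, hδ]; field_simp; ring
  have e2 : ((d:ℝ) ^ (-(1:ℝ)/(k+2))) ^ α = ((d : ℝ) ^ ((2 : ℝ) / (3 * k + 4)))⁻¹ := by
    rw [← Real.rpow_mul hd'.le, ← Real.rpow_neg hd'.le]
    congr 1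
    rw [hα]; field_simp; ring
  have e3 : L ^ α ≤ L := by
    calc L ^ α ≤ L ^ (1:ℝ) := Real.rpow_le_rpow_of_exponent_le hL1 hα1
      _ = L := Real.rpow_one L
  have e4 : (k:ℝ) ^ δ ≤ Real.exp 1 := by
    rw [Real.rpow_def_of_pos hk']
    apply Real.exp_le_exp.2
    have h1 : Real.log k ≤ k := (Real.log_le_sub_one_of_pos hk').trans (by linarith)
    have hδ0 : 0 < δ := by positivity
    calc Real.log k * δ ≤ k * δ := by gcongr
      _ ≤ 1 := by rw [hδ, mul_div_assoc', div_le_one (by positivity)]; linarith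
  rw [Real.mul_rpow (by positivity) (by positivity), Real.mul_rpow (by positivity) (by positivity), e1, e2]
  have e5 : k * B + B * Real.log d = (k*B)^((1:ℝ)/3) * (k*B)^((2:ℝ)/3) * L := by
    rw [← Real.rpow_add (by positivity)]
    norm_num
    rw [hL]; field_simp
  rw [e5]
  have hp2 : 0 < (k*B)^((2:ℝ)/3) := by positivity
  have hp1 : 0 < (d : ℝ) ^ ((2 : ℝ) / (3 * k + 4)) := by positivity
  calc (k*B)^((1:ℝ)/3) * (k ^ δ * B ^ δ) * ((d : ℝ) ^ ((2 : ℝ) / (3 * k + 4)))⁻¹ * L ^ α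
      ≤ (k*B)^((1:ℝ)/3) * (Real.exp 1 * B ^ δ) * ((d : ℝ) ^ ((2 : ℝ) / (3 * k + 4)))⁻¹ * L := by gcongr
    _ = _ := by field_simp

lemma main1 {d k : ℕ} (hd : 0 < d) (hk : 0 < k) (Λ : Measure (EE d)) [IsProbabilityMeasure Λ] {B σ : ℝ}
    (hσ0 : 0 < σ) (hX : Integrable (fun x => ‖x‖^2) Λ) (hσ : ∫ x, ‖x‖^2 ∂Λ = σ^2 * d)
    (hB : ∀ v : EE d, ∫ x, ⟪x, v⟫^2 ∂Λ ≤ B * ‖v‖^2)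
    (μ : Measure (Stiefel d k)) (hμ : IsHaarStiefel μ) :
    ∫ θ, dBL (pth Λ θ) ((gam k).map fun z => σ • z) ∂μ ≤
      9 * (14 + VV) * (√(k * B) * (d:ℝ) ^ (-(1:ℝ)/(k+2)) * (1 + Real.log d / k)) +
      √k * σ * (∫ x, |‖x‖^2 * (σ^2)⁻¹ - (d:ℝ)| ∂Λ) / ((d:ℝ) - 1) := by
  have := hμ.1
  have hk' : (0:ℝ) < k := by exact_mod_cast hk
  have hd' : (0:ℝ) < d := by exact_mod_cast hd
  have hd1 : (1:ℝ) ≤ d := by exact_mod_cast hd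
  have hV := VV_nonneg
  have hBσ := B_ge hd Λ hX hσ hB
  have hB0 : 0 < B := lt_of_lt_of_le (by positivity) hBσ
  have hlog : 0 ≤ Real.log d := Real.log_natCast_nonneg d
  set L := 1 + Real.log d / k with hL
  have hlk : 0 ≤ Real.log d / k := by positivity
  set m := √(k * B) with hm
  have hm0 : 0 < m := by positivity
  have hmB : m^2 = k * B := Real.sq_sqrt (by positivity)
  set e := (d:ℝ) ^ (-(1:ℝ)/(k+2)) with he
  have he0 : 0 < e := by positivity
  have hεd : d * (3*e)^(k+2) = 3^(k+2) := by
    rw [mul_pow, he, ← Real.rpow_natCast ((d:ℝ) ^ (-(1:ℝ)/(k+2))), ← Real.rpow_mul hd'.le]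
    have : -(1:ℝ)/(k+2) * ((k+2 : ℕ):ℝ) = -1 := by push_cast; field_simp
    rw [this, Real.rpow_neg_one]; field_simp
  have hAn : 0 ≤ ∫ x, |‖x‖^2 * (σ^2)⁻¹ - (d:ℝ)| ∂Λ := integral_nonneg fun _ => abs_nonneg _
  have := sigZ_prob k σ
  rcases le_or_gt 1 (3*e) with h1 | h1
  · have hs := sigZ_sq k σ
    have h2 : ∫ θ, dBL (pth Λ θ) ((gam k).map fun z => σ • z) ∂μ ≤ ∫ θ : Stiefel d k, 2 * m ∂μ :=
      int_le_of_pt μ (integrable_const _) (fun θ => dBL_nonneg _ _) (fun θ =>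
        triv_bound2 _ _ hm0 (pth_sq Λ hX hB θ).1 hs.1 ((pth_sq Λ hX hB θ).2.trans hmB.ge)
          (by rw [hs.2, hmB]; gcongr))
    simp only [integral_const, probReal_univ, one_smul] at h2
    have h3 : 0 ≤ √k * σ * (∫ x, |‖x‖^2 * (σ^2)⁻¹ - (d:ℝ)| ∂Λ) / ((d:ℝ) - 1) :=
      div_nonneg (by positivity) (by linarith)
    have h4 : 2 * m ≤ 9 * (14 + VV) * (m * e * L) := by
      have h5 : m ≤ m * (3 * e) := le_mul_of_one_le_right hm0.le h1
      have h6 : m * e ≤ m * e * L := le_mul_of_one_le_right (by positivity) (by linarith)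
      have h7 : 0 ≤ VV * (m * e * L) := by positivity
      nlinarith
    linarith
  · have hx : 1 ≤ ((3*e)^2)⁻¹ := by
      rw [one_le_inv₀ (by positivity)]; nlinarith
    obtain ⟨J, hJa, hJb⟩ := exists_nat_pow_near hx (by norm_num : (1:ℝ) < 2)
    have hsq : 0 < (3*e)^2 := by positivity
    have hJ2 : (2:ℝ)^J * (3*e)^2 ≤ 1 := by
      have := mul_le_mul_of_nonneg_right hJa hsq.le
      rwa [inv_mul_cancel₀ hsq.ne'] at this
    have hJ1 : 1 ≤ 2 * ((2:ℝ)^J * (3*e)^2) := by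
      have := mul_le_mul_of_nonneg_right hJb.le hsq.le
      rw [inv_mul_cancel₀ hsq.ne', pow_succ] at this
      linarith
    have hc := core hd hk Λ hσ0 hX hσ hB μ hμ hm0 (by positivity : 0 < 3*e) hmB hεd J hJ1 hJ2
    have hd2 : 2 ≤ d := by
      by_contra h
      have : d = 1 := by omega
      rw [he, this] at h1
      norm_num at h1
    have hd2' : (2:ℝ) ≤ d := by exact_mod_cast hd2
    have hW : √k * σ * (∫ x, |‖x‖^2 * (σ^2)⁻¹ - (d:ℝ)| ∂Λ) / d ≤
        √k * σ * (∫ x, |‖x‖^2 * (σ^2)⁻¹ - (d:ℝ)| ∂Λ) / ((d:ℝ) - 1) :=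
      div_le_div_of_nonneg_left (by positivity) (by linarith) (by linarith)
    have hJl : (J:ℝ) ≤ 3 * (Real.log d / k) := by
      have h2 := Real.log_le_log (by positivity) hJ2
      rw [Real.log_one, Real.log_mul (by positivity) (by positivity), Real.log_pow, Real.log_pow,
        Real.log_mul (by norm_num) he0.ne', he, Real.log_rpow hd'] at h2
      push_cast at h2
      have h3 : 0 < Real.log 3 := Real.log_pos (by norm_num)
      have h4 := Real.log_two_gt_d9
      have h5 : (1:ℝ)/(k+2) * Real.log d ≤ Real.log d / k := by
        rw [one_div, inv_mul_eq_div]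
        exact div_le_div_of_nonneg_left hlog hk' (by linarith)
      have h6 : -(1:ℝ)/(k+2) * Real.log d = -((1:ℝ)/(k+2) * Real.log d) := by ring
      rw [h6] at h2
      have h7 : (J:ℝ) * Real.log 2 ≤ 2 * (Real.log d / k) := by linarith
      have h8 : (J:ℝ) * (2/3) ≤ (J:ℝ) * Real.log 2 := by
        apply mul_le_mul_of_nonneg_left _ (by positivity); linarith
      linarith
    have h9 : 4 + ((J:ℝ)+1) * (10+VV) ≤ 3 * (14 + VV) * L := by
      have : ((J:ℝ)+1) * (10+VV) ≤ (3 * (Real.log d / k) + 1) * (10 + VV) := by gcongr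
      have h10 : 0 ≤ Real.log d / k * VV := by positivity
      rw [hL]; nlinarith
    have h11 : m * (3 * e) * (4 + ((J:ℝ)+1) * (10+VV)) ≤ m * (3 * e) * (3 * (14 + VV) * L) := by gcongr
    have h12 : m * (3 * e) * (3 * (14 + VV) * L) = 9 * (14 + VV) * (m * e * L) := by ring
    linarith

lemma main2 {d k : ℕ} (hd : 0 < d) (hk : 0 < k) (Λ : Measure (EE d)) [IsProbabilityMeasure Λ] {B σ A : ℝ}
    (hσ0 : 0 < σ) (hX : Integrable (fun x => ‖x‖^2) Λ) (hσ : ∫ x, ‖x‖^2 ∂Λ = σ^2 * d)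
    (hA : A = ∫ x, |‖x‖^2 * (σ^2)⁻¹ - (d:ℝ)| ∂Λ)
    (hB : ∀ v : EE d, ∫ x, ⟪x, v⟫^2 ∂Λ ≤ B * ‖v‖^2)
    (μ : Measure (Stiefel d k)) (hμ : IsHaarStiefel μ) :
    ∫ θ, dBL (pth Λ θ) ((gam k).map fun z => σ • z) ∂μ ≤
      9 * (14 + VV) * Real.exp 1 * (((k * B + B * Real.log d) * B ^ ((2 : ℝ) / (9 * k + 12)))
                / ((k * B) ^ ((2 : ℝ) / 3) * (d : ℝ) ^ ((2 : ℝ) / (3 * k + 4)))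
              + σ * (Real.sqrt k * (A + 1) + k) / ((d : ℝ) - 1)) := by
  have := hμ.1
  have hk' : (0:ℝ) < k := by exact_mod_cast hk
  have hd' : (0:ℝ) < d := by exact_mod_cast hd
  have hd1 : (1:ℝ) ≤ d := by exact_mod_cast hd
  have hV := VV_nonneg
  have hBσ := B_ge hd Λ hX hσ hB
  have hB0 : 0 < B := lt_of_lt_of_le (by positivity) hBσ
  have hlog : 0 ≤ Real.log d := Real.log_natCast_nonneg d
  have h1 := main1 hd hk Λ hσ0 hX hσ hB μ hμ
  rw [← hA] at h1
  have hA0 : 0 ≤ A := by rw [hA]; exact integral_nonneg fun _ => abs_nonneg _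
  have := sigZ_prob k σ
  have h2 : ∫ θ, dBL (pth Λ θ) ((gam k).map fun z => σ • z) ∂μ ≤ ∫ θ : Stiefel d k, (2:ℝ) ∂μ :=
      int_le_of_pt μ (integrable_const _) (fun θ => dBL_nonneg _ _) (fun θ => triv_bound _ _)
  simp only [integral_const, probReal_univ, one_smul] at h2
  have h3 := final_num hd hk hB0
  have hα0 : 0 < ((2:ℝ)*k+4)/(3*k+4) := by positivity
  have hα1 : ((2:ℝ)*k+4)/(3*k+4) ≤ 1 := by rw [div_le_one (by positivity)]; linarith
  have hx0 : 0 < √(k * B) * (d:ℝ) ^ (-(1:ℝ)/(k+2)) * (1 + Real.log d / k) := by positivity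
  have hW0 : 0 ≤ √k * σ * A / ((d:ℝ)-1) := div_nonneg (by positivity) (by linarith)
  have hW : √k * σ * A / ((d:ℝ)-1) ≤ σ * (Real.sqrt k * (A + 1) + k) / ((d : ℝ) - 1) := by
    refine div_le_div_of_nonneg_right ?_ (by linarith)
    have : 0 ≤ σ * (√k + k) := by positivity
    nlinarith
  have he : 1 ≤ Real.exp 1 := Real.one_le_exp (by norm_num)
  set R := ((k * B + B * Real.log d) * B ^ ((2 : ℝ) / (9 * k + 12)))
                / ((k * B) ^ ((2 : ℝ) / 3) * (d : ℝ) ^ ((2 : ℝ) / (3 * k + 4)))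
  set W := √k * σ * A / ((d:ℝ)-1)
  set x := √(k * B) * (d:ℝ) ^ (-(1:ℝ)/(k+2)) * (1 + Real.log d / k)
  have h4 : ∫ θ, dBL (pth Λ θ) ((gam k).map fun z => σ • z) ∂μ ≤
      9 * (14 + VV) * x ^ (((2:ℝ)*k+4)/(3*k+4)) + W := by
    rcases le_or_gt x 1 with hx | hx
    · have : x ≤ x ^ (((2:ℝ)*k+4)/(3*k+4)) := by
        conv_lhs => rw [← Real.rpow_one x]
        exact Real.rpow_le_rpow_of_exponent_ge hx0 hx hα1
      have h5 : 9 * (14 + VV) * x ≤ 9 * (14 + VV) * x ^ (((2:ℝ)*k+4)/(3*k+4)) := by gcongr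
      linarith
    · have := Real.one_le_rpow hx.le hα0.le
      nlinarith
  have h6 : 9 * (14 + VV) * x ^ (((2:ℝ)*k+4)/(3*k+4)) ≤ 9 * (14 + VV) * (Real.exp 1 * R) := by gcongr
  have h7 : W ≤ 9 * (14 + VV) * Real.exp 1 * (σ * (Real.sqrt k * (A + 1) + k) / ((d : ℝ) - 1)) := by
    refine hW.trans (le_mul_of_one_le_left (hW0.trans hW) ?_)
    nlinarith
  calc _ ≤ _ := h4
    _ ≤ 9 * (14 + VV) * (Real.exp 1 * R) + 9 * (14 + VV) * Real.exp 1 * (σ * (Real.sqrt k * (A + 1) + k) / ((d : ℝ) - 1)) :=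
      add_le_add h6 h7
    _ = _ := by ring

/-- **Theorem 3 (dist-bdX), first statement.** The Haar-average of the conditional
bounded-Lipschitz distance from `X_θ` to `σZ` satisfies
`𝔼 d_BL(X_θ, σZ) ≤ C[(kB + B log d) B^{2/(9k+12)} / ((kB)^{2/3} d^{2/(3k+4)})
  + σ(√k(A+1)+k)/(d-1)]` for an absolute constant `C`. -/
theorem projections_dist_bdX :
    ∃ C : ℝ, 0 < C ∧
      ∀ {Ω : Type} [MeasurableSpace Ω] (P : Measure Ω), ∀ _ : IsProbabilityMeasure P,
      ∀ (d k : ℕ), 0 < k → k ≤ d →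
      ∀ (X : Ω → EuclideanSpace ℝ (Fin d)), Measurable X →
      ∀ σ : ℝ, 0 < σ →
      Integrable (fun ω => ‖X ω‖ ^ 2) P →
      (∫ ω, X ω ∂P) = 0 →
      (∫ ω, ‖X ω‖ ^ 2 ∂P) = σ ^ 2 * d →
      ∀ A : ℝ, A = (∫ ω, |‖X ω‖ ^ 2 * (σ ^ 2)⁻¹ - (d : ℝ)| ∂P) →
      ∀ B : ℝ,
        IsLUB {r : ℝ | ∃ ξ : EuclideanSpace ℝ (Fin d), ‖ξ‖ = 1 ∧
          r = ∫ ω, ⟪X ω, ξ⟫ ^ 2 ∂P} B →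
      ∀ (μ : Measure (Stiefel d k)), IsHaarStiefel μ →
        (∫ θ, dBL (P.map fun ω => stiefelProj θ (X ω))
            ((stdGaussian k).map fun z => σ • z) ∂μ)
          ≤ C * (((k * B + B * Real.log d) * B ^ ((2 : ℝ) / (9 * k + 12)))
                / ((k * B) ^ ((2 : ℝ) / 3) * (d : ℝ) ^ ((2 : ℝ) / (3 * k + 4)))
              + σ * (Real.sqrt k * (A + 1) + k) / ((d : ℝ) - 1)) := by
  have hV := VV_nonneg
  refine ⟨9 * (14 + VV) * Real.exp 1, by positivity, ?_⟩
  intro Ω _ P hP d k hk hkd X hXm σ hσ0 hX _ hσ A hA B hB μ hμ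
  have hΛ : IsProbabilityMeasure (P.map X) := Measure.isProbabilityMeasure_map hXm.aemeasurable
  have hX' : Integrable (fun x => ‖x‖^2) (P.map X) := by
    rw [integrable_map_measure (Measurable.aestronglyMeasurable (by fun_prop)) hXm.aemeasurable]
    exact hX
  have hσ' : ∫ x, ‖x‖^2 ∂(P.map X) = σ^2 * d := by
    rw [integral_map hXm.aemeasurable (Measurable.aestronglyMeasurable (by fun_prop)), hσ]
  have hA' : A = ∫ x, |‖x‖^2 * (σ^2)⁻¹ - (d:ℝ)| ∂(P.map X) := by
    rw [integral_map hXm.aemeasurable (Measurable.aestronglyMeasurable (by fun_prop)), hA]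
  have hB' : ∀ v : EE d, ∫ x, ⟪x, v⟫^2 ∂(P.map X) ≤ B * ‖v‖^2 := by
    intro v
    rw [integral_map hXm.aemeasurable (Measurable.aestronglyMeasurable (by fun_prop))]
    by_cases hv : v = 0
    · subst hv; simp
    have hv' : ‖v‖ ≠ 0 := norm_ne_zero_iff.2 hv
    have h1 := hB.1 ⟨‖v‖⁻¹ • v, by rw [norm_smul, norm_inv, norm_norm, inv_mul_cancel₀ hv'], rfl⟩
    simp_rw [real_inner_smul_right, mul_pow] at h1
    rw [integral_const_mul, inv_pow, inv_mul_eq_div, div_le_iff₀ (by positivity)] at h1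
    exact h1
  have hmain := main2 (by omega : 0 < d) hk (P.map X) hσ0 hX' hσ' hA' hB' μ hμ
  have e1 : ∀ θ : Stiefel d k, pth (P.map X) θ = P.map fun ω => stiefelProj θ (X ω) := fun θ => by
    unfold pth
    rw [Measure.map_map (continuous_stiefelProj θ).measurable hXm]; rfl
  simp_rw [e1] at hmain
  rw [stdGaussian_eq_gam]
  exact hmain

end
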